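/- arXiv:math/0512481 — 5 statements merged into one kernel-verified Lean document; each statement's English description precedes it below -/
import Mathlib

section
/- Let k ≥ 2, let n ≥ 1, and let f : FreeGroup (Fin k) → ℂ be finitely supported with support contained in the set of positive words of length n, i.e. elements of the form (FreeGroup.of a₁) · (FreeGroup.of a₂) ⋯ (FreeGroup.of aₙ) for some a : Fin n → Fin k (no inverses of generators occur). Then for every square-summable g : FreeGroup (Fin k) → ℂ, the convolution f ⋆ g is square-summable and satisfies ‖f ⋆ g‖₂ ≤ 2¹⁰ · √e · √n · ‖f‖₂ · ‖g‖₂. -/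
open scoped NNReal ENNReal

namespace HaagerupAux

/-- Positive reduced word attached to a list of generators. -/
def pos {k : ℕ} (a : List (Fin k)) : List (Fin k × Bool) := a.map (fun i => (i, true))

/-- The product `w * (w⁻¹ * x)` cancels exactly the last `l` letters of the positive word `w`. -/
def Canc {k : ℕ} (n l : ℕ) (w x : FreeGroup (Fin k)) : Prop :=
  ∃ (v u : List (Fin k)) (z : List (Fin k × Bool)), u.length = l ∧ v.length + u.length = n ∧
    w = FreeGroup.mk (pos (v ++ u)) ∧ x.toWord = pos v ++ z ∧
    (w⁻¹ * x).toWord = FreeGroup.invRev (pos u) ++ z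

lemma pos_reduced {k : ℕ} (a : List (Fin k)) : FreeGroup.IsReduced (pos a) := by
  unfold FreeGroup.IsReduced pos
  rw [List.isChain_map]
  exact List.Pairwise.isChain (List.pairwise_of_forall (by simp))

lemma pos_inj {k : ℕ} {a b : List (Fin k)} (h : pos a = pos b) : a = b := by
  refine List.map_injective_iff.2 ?_ h
  intro i j hij
  simpa using hij

lemma mk_pos_inj {k : ℕ} {a b : List (Fin k)}
    (h : FreeGroup.mk (pos a) = FreeGroup.mk (pos b)) : a = b := by
  have h2 := congrArg FreeGroup.toWord h
  rw [FreeGroup.toWord_mk, FreeGroup.toWord_mk, (pos_reduced a).reduce_eq,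
    (pos_reduced b).reduce_eq] at h2
  exact pos_inj h2

lemma pos_length {k : ℕ} (a : List (Fin k)) : (pos a).length = a.length := by simp [pos]

lemma Canc.inj {k : ℕ} {n l : ℕ} {w w' w'' y : FreeGroup (Fin k)}
    (h1 : Canc n l w (w' * y)) (h2 : Canc n l w' (w' * y))
    (h3 : Canc n l w (w'' * y)) (h4 : Canc n l w'' (w'' * y)) : w' = w'' := by
  obtain ⟨v1, u1, z1, l1, m1, e1, x1, -⟩ := h1
  obtain ⟨v2, u2, z2, l2, m2, e2, x2, y2⟩ := h2
  obtain ⟨v3, u3, z3, l3, m3, e3, x3, -⟩ := h3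
  obtain ⟨v4, u4, z4, l4, m4, e4, x4, y4⟩ := h4
  have a13 : v1 = v3 := by
    have := mk_pos_inj (e1.symm.trans e3)
    exact (List.append_inj this (by omega)).1
  have a12 : v1 = v2 := by
    have := x1.symm.trans x2
    exact pos_inj (List.append_inj this (by simp only [pos_length]; omega)).1
  have a34 : v3 = v4 := by
    have := x3.symm.trans x4
    exact pos_inj (List.append_inj this (by simp only [pos_length]; omega)).1
  have b : u2 = u4 := by
    rw [inv_mul_cancel_left] at y2 y4
    have := y2.symm.trans y4
    have := (List.append_inj this (by simp only [FreeGroup.invRev_length, pos_length]; omega)).1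
    exact pos_inj (FreeGroup.invRev_injective this)
  rw [e2, e4, ← a12, ← a34, a13, b]

lemma split {k : ℕ} (a : List (Fin k)) : ∀ X : List (Fin k × Bool), FreeGroup.IsReduced X →
    ∃ (v u : List (Fin k)) (z : List (Fin k × Bool)), a = v ++ u ∧ X = pos v ++ z ∧
      FreeGroup.IsReduced (FreeGroup.invRev (pos u) ++ z) := by
  induction a with
  | nil => intro X hX; exact ⟨[], [], X, by simp, by simp [pos], by simpa [pos] using hX⟩
  | cons i a ih =>
    intro X hX
    by_cases h : ∃ X', X = (i, true) :: X'
    · obtain ⟨X', rfl⟩ := h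
      obtain ⟨v, u, z, h1, h2, h3⟩ := ih X' (List.IsChain.tail hX)
      exact ⟨i :: v, u, z, by simp [h1], by simp [h2, pos], h3⟩
    · refine ⟨[], i :: a, X, by simp, by simp [pos], ?_⟩
      unfold FreeGroup.IsReduced
      rw [List.isChain_append]
      refine ⟨?_, hX, ?_⟩
      · have : FreeGroup.invRev (pos (i :: a)) = ((i :: a).reverse).map (fun i => (i, false)) := by
          simp [FreeGroup.invRev, pos]
        rw [this, List.isChain_map]
        exact List.Pairwise.isChain (List.pairwise_of_forall (by simp))
      · intro p hp q hq
        have hp' : p = (i, false) := by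
          simp [FreeGroup.invRev, pos] at hp
          exact hp.symm
        subst hp'
        cases X with
        | nil => simp at hq
        | cons c X =>
          simp at hq
          subst hq
          obtain ⟨c1, c2⟩ := c
          simp at h ⊢
          rintro rfl
          simpa using h

/-- length of the maximal initial segment of sign `b` -/
def pre {k : ℕ} (b : Bool) (x : FreeGroup (Fin k)) : ℕ :=
  (x.toWord.takeWhile (fun c => c.2 == b)).length

lemma pre_eq {k : ℕ} (b : Bool) (A z : List (Fin k × Bool)) (hA : ∀ c ∈ A, c.2 = b)
    (hz : ∀ c ∈ z.head?, c.2 ≠ b) :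
    ((A ++ z).takeWhile (fun c => c.2 == b)).length = A.length := by
  rw [List.takeWhile_append_of_pos (by simpa using hA)]
  cases z with
  | nil => simp
  | cons c z =>
    simp at hz
    simp [hz]

lemma cover {k : ℕ} (n : ℕ) (a : List (Fin k)) (ha : a.length = n) (x : FreeGroup (Fin k)) :
    Canc n (n - pre true x) (FreeGroup.mk (pos a)) x ∨
    (pre false ((FreeGroup.mk (pos a))⁻¹ * x) ≤ n ∧
      Canc n (pre false ((FreeGroup.mk (pos a))⁻¹ * x)) (FreeGroup.mk (pos a)) x) := by
  obtain ⟨v, u, z, h1, h2, h3⟩ := split a x.toWord FreeGroup.isReduced_toWord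
  have hlen : v.length + u.length = n := by rw [← ha, h1]; simp
  have hy : ((FreeGroup.mk (pos a))⁻¹ * x).toWord = FreeGroup.invRev (pos u) ++ z := by
    have : (FreeGroup.mk (pos a))⁻¹ * x = FreeGroup.mk (FreeGroup.invRev (pos u) ++ z) := by
      rw [← FreeGroup.mk_toWord (x := x), h2, h1]
      have e : pos (v ++ u) = pos v ++ pos u := by simp [pos]
      rw [e, ← FreeGroup.mul_mk, ← FreeGroup.mul_mk, ← FreeGroup.mul_mk, ← FreeGroup.inv_mk]
      group
    rw [this, FreeGroup.toWord_mk, h3.reduce_eq]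
  have hC : Canc n u.length (FreeGroup.mk (pos a)) x := ⟨v, u, z, rfl, hlen, by rw [h1], h2, hy⟩
  by_cases hz : ∀ c ∈ z.head?, c.2 ≠ true
  · left
    have : pre true x = v.length := by
      unfold pre
      rw [h2, pre_eq true _ _ (by simp [pos]) hz, pos_length]
    rw [this, show n - v.length = u.length by omega]
    exact hC
  · right
    have : pre false ((FreeGroup.mk (pos a))⁻¹ * x) = u.length := by
      unfold pre
      rw [hy, pre_eq false _ _ (by simp [pos, FreeGroup.invRev]) ?_, FreeGroup.invRev_length, pos_length]
      cases z with
      | nil => simp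
      | cons c z => simpa using hz
    rw [this]
    exact ⟨by omega, hC⟩

open Classical in
lemma schur {G : Type*} [Group G] (S : Finset G) (R : G → G → Prop)
    (hR : ∀ w w' w'' y, R w (w' * y) → R w' (w' * y) → R w (w'' * y) → R w'' (w'' * y) → w' = w'')
    (F H : G → ℝ≥0) :
    ∑' x, ((∑ w ∈ S with R w x, F w * H (w⁻¹ * x) : ℝ≥0) : ℝ≥0∞) ^ 2 ≤
      (∑ w ∈ S, (F w : ℝ≥0∞) ^ 2) * ∑' y, (H y : ℝ≥0∞) ^ 2 := by
  calc ∑' x, ((∑ w ∈ S with R w x, F w * H (w⁻¹ * x) : ℝ≥0) : ℝ≥0∞) ^ 2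
      ≤ ∑' x, ∑ w ∈ S, ∑ w' ∈ S, if R w x ∧ R w' x then
          (F w : ℝ≥0∞) ^ 2 * (H (w'⁻¹ * x) : ℝ≥0∞) ^ 2 else 0 := by
        refine ENNReal.tsum_le_tsum fun x => ?_
        have := Finset.sum_mul_sq_le_sq_mul_sq (S.filter (fun w => R w x)) F
          (fun w => H (w⁻¹ * x))
        have h2 : ((∑ w ∈ S with R w x, F w * H (w⁻¹ * x) : ℝ≥0) : ℝ≥0∞) ^ 2 ≤
          (((∑ w ∈ S with R w x, F w ^ 2) * ∑ w ∈ S with R w x, H (w⁻¹ * x) ^ 2 : ℝ≥0) : ℝ≥0∞) := by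
          exact_mod_cast this
        refine h2.trans (le_of_eq ?_)
        push_cast
        rw [Finset.sum_mul_sum, Finset.sum_filter]
        refine Finset.sum_congr rfl fun w _ => ?_
        by_cases h : R w x
        · simp [h, Finset.sum_filter]
        · simp [h]
    _ = ∑ w ∈ S, ∑ w' ∈ S, ∑' x, if R w x ∧ R w' x then
          (F w : ℝ≥0∞) ^ 2 * (H (w'⁻¹ * x) : ℝ≥0∞) ^ 2 else 0 := by
        rw [Summable.tsum_finsetSum (fun _ _ => ENNReal.summable)]
        refine Finset.sum_congr rfl fun w _ => ?_
        rw [Summable.tsum_finsetSum (fun _ _ => ENNReal.summable)]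
    _ = ∑ w ∈ S, ∑ w' ∈ S, ∑' y, if R w (w' * y) ∧ R w' (w' * y) then
          (F w : ℝ≥0∞) ^ 2 * (H y : ℝ≥0∞) ^ 2 else 0 := by
        refine Finset.sum_congr rfl fun w _ => Finset.sum_congr rfl fun w' _ => ?_
        rw [← (Equiv.mulLeft w').tsum_eq]
        simp
    _ = ∑ w ∈ S, ∑' y, ∑ w' ∈ S, if R w (w' * y) ∧ R w' (w' * y) then
          (F w : ℝ≥0∞) ^ 2 * (H y : ℝ≥0∞) ^ 2 else 0 := by
        refine Finset.sum_congr rfl fun w _ => ?_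
        rw [Summable.tsum_finsetSum (fun _ _ => ENNReal.summable)]
    _ ≤ ∑ w ∈ S, ∑' y, (F w : ℝ≥0∞) ^ 2 * (H y : ℝ≥0∞) ^ 2 := by
        refine Finset.sum_le_sum fun w _ => ENNReal.tsum_le_tsum fun y => ?_
        rw [← Finset.sum_filter, Finset.sum_const]
        have hc : (S.filter (fun w' => R w (w' * y) ∧ R w' (w' * y))).card ≤ 1 := by
          refine Finset.card_le_one.2 fun a ha b hb => ?_
          simp only [Finset.mem_filter] at ha hb
          exact hR w a b y ha.2.1 ha.2.2 hb.2.1 hb.2.2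
        calc _ ≤ 1 • ((F w : ℝ≥0∞) ^ 2 * (H y : ℝ≥0∞) ^ 2) := nsmul_le_nsmul_left (zero_le) hc
          _ = _ := one_nsmul _
    _ = _ := by
        simp_rw [ENNReal.tsum_mul_left]
        rw [Finset.sum_mul]

open Classical in
/-- The part of the convolution with `l` cancelled letters. -/
noncomputable def T {k : ℕ} (n : ℕ) (S : Finset (FreeGroup (Fin k)))
    (F : FreeGroup (Fin k) → ℝ≥0) (l : ℕ) (H : FreeGroup (Fin k) → ℝ≥0)
    (x : FreeGroup (Fin k)) : ℝ≥0 :=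
  ∑ w ∈ S with Canc n l w x, F w * H (w⁻¹ * x)

lemma T_bound {k : ℕ} (n : ℕ) (S : Finset (FreeGroup (Fin k)))
    (F : FreeGroup (Fin k) → ℝ≥0) (l : ℕ) (H : FreeGroup (Fin k) → ℝ≥0) :
    ∑' x, (T n S F l H x : ℝ≥0∞) ^ 2 ≤
      (∑ w ∈ S, (F w : ℝ≥0∞) ^ 2) * ∑' y, (H y : ℝ≥0∞) ^ 2 :=
  schur S (Canc n l) (fun _ _ _ _ h1 h2 h3 h4 => h1.inj h2 h3 h4) F H

/-- restriction of `H` to elements with maximal negative initial segment of length `l` -/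
noncomputable def res {k : ℕ} (l : ℕ) (H : FreeGroup (Fin k) → ℝ≥0)
    (y : FreeGroup (Fin k)) : ℝ≥0 := if pre false y = l then H y else 0

lemma pointwise {k : ℕ} (n : ℕ) (S : Finset (FreeGroup (Fin k)))
    (hS : ∀ w ∈ S, ∃ a : List (Fin k), a.length = n ∧ w = FreeGroup.mk (pos a))
    (F H : FreeGroup (Fin k) → ℝ≥0) (x : FreeGroup (Fin k)) :
    ∑ w ∈ S, F w * H (w⁻¹ * x) ≤ T n S F (n - pre true x) H x +
      ∑ l ∈ Finset.range (n + 1), T n S F l (res l H) x := by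
  classical
  unfold T
  simp_rw [Finset.sum_filter]
  rw [Finset.sum_comm, ← Finset.sum_add_distrib]
  refine Finset.sum_le_sum fun w hw => ?_
  obtain ⟨a, ha, rfl⟩ := hS w hw
  rcases cover n a ha x with h | ⟨h, h'⟩
  · rw [if_pos h]
    exact le_self_add
  · refine le_trans ?_ le_add_self
    refine le_trans ?_ (Finset.single_le_sum (fun _ _ => zero_le)
      (Finset.mem_range.2 (Nat.lt_succ_of_le h)))
    rw [if_pos h']
    simp [res]

lemma sum_res {k : ℕ} (n : ℕ) (H : FreeGroup (Fin k) → ℝ≥0) :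
    ∑ l ∈ Finset.range (n + 1), ∑' y, (res l H y : ℝ≥0∞) ^ 2 ≤ ∑' y, (H y : ℝ≥0∞) ^ 2 := by
  rw [← Summable.tsum_finsetSum (fun _ _ => ENNReal.summable)]
  refine ENNReal.tsum_le_tsum fun y => ?_
  by_cases h : pre false y ∈ Finset.range (n + 1)
  · rw [Finset.sum_eq_single_of_mem _ h]
    · simp [res]
    · intro b _ hb
      simp [res, hb.symm]
  · rw [Finset.sum_eq_zero]
    · exact zero_le
    · intro b hb
      have : pre false y ≠ b := by rintro rfl; exact h hb
      simp [res, this]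

lemma main {k : ℕ} (n : ℕ) (S : Finset (FreeGroup (Fin k)))
    (hS : ∀ w ∈ S, ∃ a : List (Fin k), a.length = n ∧ w = FreeGroup.mk (pos a))
    (F H : FreeGroup (Fin k) → ℝ≥0) :
    ∑' x, ((∑ w ∈ S, F w * H (w⁻¹ * x) : ℝ≥0) : ℝ≥0∞) ^ 2 ≤
      4 * (n + 1) * ((∑ w ∈ S, (F w : ℝ≥0∞) ^ 2) * ∑' y, (H y : ℝ≥0∞) ^ 2) := by
  set A := ∑ w ∈ S, (F w : ℝ≥0∞) ^ 2 with hA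
  set B := ∑' y, (H y : ℝ≥0∞) ^ 2 with hB
  calc ∑' x, ((∑ w ∈ S, F w * H (w⁻¹ * x) : ℝ≥0) : ℝ≥0∞) ^ 2
      ≤ ∑' x, ((2 * ∑ l ∈ Finset.range (n + 1), (T n S F l H x : ℝ≥0∞) ^ 2) +
          2 * ((n + 1) * ∑ l ∈ Finset.range (n + 1), (T n S F l (res l H) x : ℝ≥0∞) ^ 2)) := by
        refine ENNReal.tsum_le_tsum fun x => ?_
        have h1 := pointwise n S hS F H x
        have h2 : T n S F (n - pre true x) H x ^ 2 ≤
            ∑ l ∈ Finset.range (n + 1), T n S F l H x ^ 2 :=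
          Finset.single_le_sum (f := fun l => T n S F l H x ^ 2) (fun _ _ => zero_le)
            (Finset.mem_range.2 (by omega))
        have h3 := sq_sum_le_card_mul_sum_sq (s := Finset.range (n + 1))
          (f := fun l => T n S F l (res l H) x)
        rw [Finset.card_range] at h3
        have h4 : (∑ w ∈ S, F w * H (w⁻¹ * x)) ^ 2 ≤
            2 * ∑ l ∈ Finset.range (n + 1), T n S F l H x ^ 2 +
            2 * (((n + 1 : ℕ) : ℝ≥0) * ∑ l ∈ Finset.range (n + 1), T n S F l (res l H) x ^ 2) := by
          calc _ ≤ _ := pow_le_pow_left' h1 2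
            _ ≤ _ := add_sq_le
            _ ≤ _ := by rw [mul_add]; gcongr
        exact_mod_cast h4
    _ = 2 * ∑ l ∈ Finset.range (n + 1), ∑' x, (T n S F l H x : ℝ≥0∞) ^ 2 +
          2 * ((n + 1) * ∑ l ∈ Finset.range (n + 1), ∑' x, (T n S F l (res l H) x : ℝ≥0∞) ^ 2) := by
        rw [ENNReal.tsum_add, ENNReal.tsum_mul_left, ENNReal.tsum_mul_left, ENNReal.tsum_mul_left,
          Summable.tsum_finsetSum (fun _ _ => ENNReal.summable),
          Summable.tsum_finsetSum (fun _ _ => ENNReal.summable)]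
    _ ≤ 2 * ∑ l ∈ Finset.range (n + 1), (A * B) + 2 * ((n + 1) *
          ∑ l ∈ Finset.range (n + 1), (A * ∑' y, (res l H y : ℝ≥0∞) ^ 2)) := by
        gcongr with l _ l _
        · exact T_bound n S F l H
        · exact T_bound n S F l (res l H)
    _ ≤ 2 * ((n + 1) * (A * B)) + 2 * ((n + 1) * (A * B)) := by
        rw [← Finset.mul_sum (s := Finset.range (n + 1)) (a := A)
          (f := fun l => ∑' y, (res l H y : ℝ≥0∞) ^ 2)]
        gcongr
        · rw [Finset.sum_const, Finset.card_range, nsmul_eq_mul]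
          push_cast
          exact le_rfl
        · exact sum_res n H
    _ = _ := by ring

end HaagerupAux

/-- The strong Haagerup inequality on the free semigroup: a finitely supported
function supported on positive words of length `n` (words in the generators only,
no inverses) acts as a convolutor on `ℓ²(F_k)` with convolution norm at most
`2^10 √e √n` times its `ℓ²`-norm. -/
theorem strong_haagerup_inequality_free_semigroup
    (k : ℕ) (hk : 2 ≤ k) (n : ℕ) (hn : 1 ≤ n)
    (f : FreeGroup (Fin k) → ℂ) (hf : (Function.support f).Finite)
    (hsupp : ∀ x : FreeGroup (Fin k), f x ≠ 0 →
      ∃ a : Fin n → Fin k, x = (List.ofFn (fun i => FreeGroup.of (a i))).prod)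
    (g : FreeGroup (Fin k) → ℂ) (hg : Summable (fun x => ‖g x‖ ^ 2))
    (conv : FreeGroup (Fin k) → ℂ)
    (hconv : ∀ x, conv x = ∑ᶠ y ∈ Function.support f, f y * g (y⁻¹ * x)) :
    Summable (fun x => ‖conv x‖ ^ 2) ∧
      Real.sqrt (∑' x, ‖conv x‖ ^ 2) ≤
        2 ^ 10 * Real.sqrt (Real.exp 1) * Real.sqrt n *
          Real.sqrt (∑' x, ‖f x‖ ^ 2) * Real.sqrt (∑' x, ‖g x‖ ^ 2) := by
  classical
  set Cf := ∑' x, ‖f x‖ ^ 2 with hCf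
  set Cg := ∑' x, ‖g x‖ ^ 2 with hCg
  have hCf0 : 0 ≤ Cf := tsum_nonneg fun _ => by positivity
  have hCg0 : 0 ≤ Cg := tsum_nonneg fun _ => by positivity
  have hS : ∀ w ∈ hf.toFinset, ∃ a : List (Fin k), a.length = n ∧
      w = FreeGroup.mk (HaagerupAux.pos a) := by
    intro w hw
    obtain ⟨a, rfl⟩ := hsupp w (by simpa using hw)
    refine ⟨List.ofFn a, by simp, ?_⟩
    have : ∀ L : List (Fin k), (L.map FreeGroup.of).prod = FreeGroup.mk (HaagerupAux.pos L) := by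
      intro L
      induction L with
      | nil => rfl
      | cons i L ih =>
        rw [List.map_cons, List.prod_cons, ih, FreeGroup.of, FreeGroup.mul_mk]
        rfl
    rw [← this, List.map_ofFn]
    rfl
  have hmain := HaagerupAux.main n hf.toFinset hS (fun w => ‖f w‖₊) (fun w => ‖g w‖₊)
  have e : ∀ z : ℂ, (‖z‖₊ : ENNReal) ^ 2 = ENNReal.ofReal (‖z‖ ^ 2) := by
    intro z
    rw [ENNReal.ofReal_pow (norm_nonneg z), ofReal_norm]
    rfl
  have eF : ∑ w ∈ hf.toFinset, (‖f w‖₊ : ENNReal) ^ 2 = ENNReal.ofReal Cf := by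
    simp_rw [e]
    rw [← ENNReal.ofReal_sum_of_nonneg (fun _ _ => by positivity), hCf,
      tsum_eq_sum (s := hf.toFinset)]
    intro b hb
    have : f b = 0 := by simpa using hb
    simp [this]
  have eG : ∑' y, (‖g y‖₊ : ENNReal) ^ 2 = ENNReal.ofReal Cg := by
    simp_rw [e]
    rw [hCg, ENNReal.ofReal_tsum_of_nonneg (fun _ => by positivity) hg]
  have hpt : ∀ x, ENNReal.ofReal (‖conv x‖ ^ 2) ≤
      ((∑ w ∈ hf.toFinset, ‖f w‖₊ * ‖g (w⁻¹ * x)‖₊ : NNReal) : ENNReal) ^ 2 := by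
    intro x
    rw [← e]
    have : ‖conv x‖₊ ≤ ∑ w ∈ hf.toFinset, ‖f w‖₊ * ‖g (w⁻¹ * x)‖₊ := by
      rw [hconv x, finsum_mem_eq_finite_toFinset_sum _ hf]
      refine (nnnorm_sum_le _ _).trans (le_of_eq ?_)
      simp only [nnnorm_mul]
    gcongr
  have hD : ∑' x, ENNReal.ofReal (‖conv x‖ ^ 2) ≤ ENNReal.ofReal (4 * (n + 1) * (Cf * Cg)) := by
    refine (ENNReal.tsum_le_tsum hpt).trans (hmain.trans (le_of_eq ?_))
    rw [eF, eG, ENNReal.ofReal_mul (by positivity), ENNReal.ofReal_mul hCf0,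
      ENNReal.ofReal_mul (by norm_num), ENNReal.ofReal_add (by positivity) (by norm_num)]
    simp
  have hfin : ∀ u : Finset (FreeGroup (Fin k)),
      ∑ x ∈ u, ‖conv x‖ ^ 2 ≤ 4 * (n + 1) * (Cf * Cg) := by
    intro u
    rw [← ENNReal.ofReal_le_ofReal_iff (by positivity),
      ENNReal.ofReal_sum_of_nonneg (fun _ _ => by positivity)]
    exact (ENNReal.sum_le_tsum u).trans hD
  refine ⟨summable_of_sum_le (fun _ => by positivity) hfin, ?_⟩
  have hle := Real.tsum_le_of_sum_le (fun _ => by positivity) hfin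
  have hn1 : (1 : ℝ) ≤ n := by exact_mod_cast hn
  have he : (1 : ℝ) ≤ Real.exp 1 := Real.one_le_exp (by norm_num)
  refine Real.sqrt_le_iff.2 ⟨by positivity, hle.trans ?_⟩
  simp only [mul_pow]
  rw [Real.sq_sqrt (Real.exp_pos 1).le, Real.sq_sqrt (by positivity : (0 : ℝ) ≤ n),
    Real.sq_sqrt hCf0, Real.sq_sqrt hCg0]
  have h8 : (4 * (n + 1) : ℝ) ≤ (2 ^ 10) ^ 2 * Real.exp 1 * n := by nlinarith
  calc _ ≤ (2 ^ 10) ^ 2 * Real.exp 1 * n * (Cf * Cg) := by gcongr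
    _ = _ := by ring
end

section
/- For all n, m ≥ 1, the number of elements of NC₂*(n,m) equals the Fuss–Catalan number C^{(n)}_m = (1/m)·binom(m(n+1), m−1); equivalently, m · |NC₂*(n,m)| = binom(m(n+1), m−1). -/
/-- A partition (equivalence relation) of `Fin N` is noncrossing if there are no
`p < q < p' < q'` with `p ∼ p'`, `q ∼ q'` but `p ≁ q`. -/
def IsNoncrossing {N : ℕ} (π : Setoid (Fin N)) : Prop :=
  ¬ ∃ p q p' q' : Fin N, p < q ∧ q < p' ∧ p' < q' ∧ π.r p p' ∧ π.r q q' ∧ ¬ π.r p q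

/-- A pair partition: every element lies in a block of exactly two elements. -/
def IsPairPartition {N : ℕ} (π : Setoid (Fin N)) : Prop :=
  ∀ p : Fin N, ∃! q : Fin N, q ≠ p ∧ π.r p q

/-- Position `p` (in `{0,…,2nm−1}`) is a `c`-position if `⌊p/n⌋` is even. -/
def IsCPos (n p : ℕ) : Prop := (p / n) % 2 = 0

/-- The label of position `p`: `n − (p mod n)` on `c`-positions and
`(p mod n) + 1` on `c∗`-positions. -/
def posLabel (n p : ℕ) : ℕ := if (p / n) % 2 = 0 then n - p % n else p % n + 1

/-- `π ∈ NC₂*(n,m)`: a noncrossing pair partition of `{0,…,2nm−1}` each of whose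
blocks contains exactly one `c`-position and one `c∗`-position. -/
def IsStarPairing (n m : ℕ) (π : Setoid (Fin (2 * n * m))) : Prop :=
  IsNoncrossing π ∧ IsPairPartition π ∧
    ∀ p q : Fin (2 * n * m), p ≠ q → π.r p q → (IsCPos n p.val ↔ ¬ IsCPos n q.val)


/-- weight -/
def ncW (col : ℕ → Bool) (i k : ℕ) : ℕ := if col i = col k then 0 else 1

theorem ncW_comm (col : ℕ → Bool) (i k : ℕ) : ncW col i k = ncW col k i := by
  unfold ncW; simp only [eq_comm]

theorem ncW_self (col : ℕ → Bool) (i : ℕ) : ncW col i i = 0 := by simp [ncW]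

/-- number of noncrossing pairings of the interval `[i,j)`, by recursion. -/
def ncF (col : ℕ → Bool) (i j : ℕ) : ℕ :=
  if i < j then
    ∑ k ∈ (Finset.Ioo i j).attach, ncW col i k.1 * (ncF col (i + 1) k.1 * ncF col (k.1 + 1) j)
  else 1
termination_by j - i
decreasing_by
  · have := Finset.mem_Ioo.1 k.2; omega
  · have := Finset.mem_Ioo.1 k.2; omega

theorem ncF_of_le (col : ℕ → Bool) {i j : ℕ} (h : j ≤ i) : ncF col i j = 1 := by
  rw [ncF, if_neg (by omega)]

theorem ncF_left (col : ℕ → Bool) {i j : ℕ} (h : i < j) :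
    ncF col i j = ∑ k ∈ Finset.Ioo i j, ncW col i k * (ncF col (i + 1) k * ncF col (k + 1) j) := by
  rw [ncF, if_pos h]
  exact Finset.sum_attach (Finset.Ioo i j)
    (fun k => ncW col i k * (ncF col (i + 1) k * ncF col (k + 1) j))

theorem ncF_right (col : ℕ → Bool) (L : ℕ) : ∀ i J : ℕ, J = i + L →
    ncF col i (J + 1) = ∑ l ∈ Finset.Ico i J, ncW col l J * (ncF col i l * ncF col (l + 1) J) := by
  induction L using Nat.strong_induction_on with
  | _ L ih =>
    intro i J hJ
    rw [ncF_left col (by omega)]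
    rcases Nat.eq_zero_or_pos L with h0 | hpos
    · subst h0
      have : J = i := by omega
      subst this
      rw [Finset.Ico_self]
      have : Finset.Ioo J (J + 1) = ∅ := by ext x; simp
      rw [this]; simp
    have e1 : Finset.Ioo i (J + 1) = insert J (Finset.Ioo i J) := by
      ext x; simp only [Finset.mem_Ioo, Finset.mem_insert]; omega
    have e2 : Finset.Ico i J = insert i (Finset.Ioo i J) := by
      ext x; simp only [Finset.mem_Ioo, Finset.mem_insert, Finset.mem_Ico]; omega
    rw [e1, e2, Finset.sum_insert (by simp), Finset.sum_insert (by simp)]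
    rw [ncF_of_le col (le_refl i), ncF_of_le col (le_refl (J + 1)), mul_one, one_mul]
    congr 1
    have l1 : ∀ k ∈ Finset.Ioo i J, ncW col i k * (ncF col (i + 1) k * ncF col (k + 1) (J + 1))
        = ∑ l ∈ Finset.Ico (k + 1) J, ncW col i k * (ncF col (i + 1) k *
          (ncW col l J * (ncF col (k + 1) l * ncF col (l + 1) J))) := by
      intro k hk
      rw [Finset.mem_Ioo] at hk
      rw [ih (J - (k + 1)) (by omega) (k + 1) J (by omega), Finset.mul_sum, Finset.mul_sum]
    have l2 : ∀ l ∈ Finset.Ioo i J, ncW col l J * (ncF col i l * ncF col (l + 1) J)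
        = ∑ k ∈ Finset.Ioo i l, ncW col i k * (ncF col (i + 1) k *
          (ncW col l J * (ncF col (k + 1) l * ncF col (l + 1) J))) := by
      intro l hl
      rw [Finset.mem_Ioo] at hl
      rw [ncF_left col hl.1, Finset.sum_mul, Finset.mul_sum]
      apply Finset.sum_congr rfl
      intros; ring
    rw [Finset.sum_congr rfl l1, Finset.sum_congr rfl l2]
    apply Finset.sum_comm'
    intro x y
    simp only [Finset.mem_Ioo, Finset.mem_Ico]
    omega

theorem ncF_rot (col : ℕ → Bool) (i L : ℕ) (h : col (i + L) = col i) :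
    ncF col i (i + L) = ncF col (i + 1) (i + L + 1) := by
  rcases Nat.eq_zero_or_pos L with h0 | hpos
  · subst h0; rw [ncF_of_le _ (by omega), ncF_of_le _ (by omega)]
  rw [ncF_left col (by omega), ncF_right col (L - 1) (i + 1) (i + L) (by omega)]
  have : Finset.Ioo i (i + L) = Finset.Ico (i + 1) (i + L) := by ext x; simp [Finset.mem_Ioo, Finset.mem_Ico]
  rw [this]
  apply Finset.sum_congr rfl
  intro k _
  have : ncW col i k = ncW col k (i + L) := by
    rw [ncW_comm]; unfold ncW; rw [h]
  rw [this]

theorem ncF_rot' (col : ℕ → Bool) (L : ℕ) (h : ∀ i, col (i + L) = col i) (i : ℕ) :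
    ncF col i (i + L) = ncF col 0 L := by
  induction i with
  | zero => simp
  | succ i ih => rw [← ih, ncF_rot col i L (h i)]; congr 1; omega

theorem ncF_bal (col : ℕ → Bool) (h : ℕ → ℤ)
    (hs : ∀ x, h (x + 1) = h x + (if col x then 1 else -1)) (L : ℕ) :
    ∀ i j, j = i + L → ncF col i j ≠ 0 → h i = h j := by
  induction L using Nat.strong_induction_on with
  | _ L ih =>
    intro i j hij hne
    rcases Nat.eq_zero_or_pos L with h0 | hpos
    · subst h0; simp at hij; rw [hij]
    rw [ncF_left col (by omega)] at hne
    obtain ⟨k, hk, hk2⟩ := Finset.exists_ne_zero_of_sum_ne_zero hne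
    rw [Finset.mem_Ioo] at hk
    have a1 : ncW col i k ≠ 0 := fun h => hk2 (by rw [h, zero_mul])
    have a2 : ncF col (i + 1) k ≠ 0 := fun h => hk2 (by rw [h]; ring)
    have a3 : ncF col (k + 1) j ≠ 0 := fun h => hk2 (by rw [h]; ring)
    have b2 := ih (k - (i + 1)) (by omega) _ _ (by omega) a2
    have b3 := ih (j - (k + 1)) (by omega) _ _ (by omega) a3
    have c1 := hs i
    have c2 := hs k
    have : col i ≠ col k := by
      intro h; apply a1; simp [ncW, h]
    revert c1 c2 this
    cases col i <;> cases col k <;> simp <;> intros <;> omega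

/-- the colouring -/
def scol (n p : ℕ) : Bool := decide (p % (2 * n) < n)

/-- height -/
def sht (n p : ℕ) : ℤ := if p % (2 * n) ≤ n then ((p % (2 * n) : ℕ) : ℤ) else 2 * n - ((p % (2 * n) : ℕ) : ℤ)

theorem scol_iff (n p : ℕ) (hn : 1 ≤ n) : scol n p = true ↔ (p / n) % 2 = 0 := by
  unfold scol
  rw [decide_eq_true_iff, mul_comm, Nat.mod_mul]
  have := Nat.mod_lt p (show 0 < n by omega)
  rcases Nat.mod_two_eq_zero_or_one (p / n) with h | h <;> rw [h] <;> simp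
  exact this

theorem sht_step (n : ℕ) (hn : 1 ≤ n) (x : ℕ) :
    sht n (x + 1) = sht n x + (if scol n x then 1 else -1) := by
  unfold sht scol
  have h1 := Nat.mod_lt x (show 0 < 2 * n by omega)
  have : (x + 1) % (2 * n) = if x % (2 * n) + 1 = 2 * n then 0 else x % (2 * n) + 1 := by
    rw [Nat.add_mod_eq_ite, Nat.mod_eq_of_lt (show 1 < 2 * n by omega)]
    split_ifs <;> omega
  rw [this]
  generalize x % (2 * n) = s at *
  simp only [decide_eq_true_eq]
  split_ifs <;> push_cast <;> omega

theorem scol_add (n j i : ℕ) : scol n (i + 2 * n * j) = scol n i := by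
  unfold scol; rw [Nat.add_mul_mod_self_left]

/-- the sequence -/
def sf (n j : ℕ) : ℕ := ncF (scol n) 0 (2 * n * j)

theorem sf_rot (n j i k : ℕ) (h : k = i + 2 * n * j) : ncF (scol n) i k = sf n j := by
  subst h
  exact ncF_rot' _ _ (scol_add n j) i

theorem sA_rec (n : ℕ) (hn : 1 ≤ n) (r j : ℕ) (hr : r < n) :
    ncF (scol n) r (2 * n * j + 2 * n - r) = ∑ l ∈ Finset.range (j + 1),
      ncF (scol n) (r + 1) (2 * n * l + 2 * n - (r + 1)) * sf n (j - l) := by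
  rw [ncF_left _ (by omega)]
  symm
  have hmod : ∀ l, (2 * n * l + 2 * n - (r + 1)) % (2 * n) = 2 * n - (r + 1) := by
    intro l
    rw [show 2 * n * l + 2 * n - (r + 1) = (2 * n - (r + 1)) + 2 * n * l by omega,
      Nat.add_mul_mod_self_left, Nat.mod_eq_of_lt (by omega)]
  apply Finset.sum_of_injOn (fun l => 2 * n * l + 2 * n - (r + 1))
  · intro a _ b _ hab
    simp only at hab
    have : 2 * n * a = 2 * n * b := by omega
    exact Nat.eq_of_mul_eq_mul_left (by omega) this
  · intro l hl
    simp only [Finset.coe_range, Set.mem_Iio, Finset.coe_Ioo, Set.mem_Ioo] at *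
    have : 2 * n * l ≤ 2 * n * j := Nat.mul_le_mul_left _ (by omega)
    omega
  · intro k hk hk2
    rw [Finset.mem_Ioo] at hk
    by_contra hne
    have a1 : ncW (scol n) r k ≠ 0 := fun h => hne (by rw [h, zero_mul])
    have a2 : ncF (scol n) (r + 1) k ≠ 0 := fun h => hne (by rw [h]; ring)
    have b := ncF_bal (scol n) (sht n) (sht_step n hn) (k - (r + 1)) _ _ (by omega) a2
    have c : scol n r ≠ scol n k := by intro h; apply a1; simp [ncW, h]
    have d : k % (2 * n) = 2 * n - (r + 1) := by
      unfold sht at b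
      unfold scol at c
      have h1 := Nat.mod_lt k (show 0 < 2 * n by omega)
      rw [Nat.mod_eq_of_lt (show r + 1 < 2 * n by omega)] at b
      rw [Nat.mod_eq_of_lt (show r < 2 * n by omega)] at c
      have c' : ¬ (k % (2 * n) < n) := by
        intro h; apply c; simp [h, hr]
      split_ifs at b <;> omega
    apply hk2
    have e := Nat.div_add_mod k (2 * n)
    refine ⟨k / (2 * n), ?_, ?_⟩
    · simp only [Finset.coe_range, Set.mem_Iio]
      by_contra hc
      have : 2 * n * (j + 1) ≤ 2 * n * (k / (2 * n)) := Nat.mul_le_mul_left _ (by omega)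
      rw [mul_add] at this
      omega
    · simp only; omega
  · intro l hl
    rw [Finset.mem_range] at hl
    have hW : ncW (scol n) r (2 * n * l + 2 * n - (r + 1)) = 1 := by
      unfold ncW scol
      rw [hmod, Nat.mod_eq_of_lt (show r < 2 * n by omega)]
      rw [if_neg]
      simp only [decide_eq_decide]
      omega
    rw [hW, one_mul]
    congr 1
    symm
    apply sf_rot
    have : 2 * n * j = 2 * n * l + 2 * n * (j - l) := by rw [← mul_add]; congr 1; omega
    omega

open PowerSeries in
theorem sA_pow (n : ℕ) (hn : 1 ≤ n) (d : ℕ) (hd : d ≤ n) (j : ℕ) :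
    ncF (scol n) (n - d) (2 * n * j + 2 * n - (n - d)) =
      coeff j ((PowerSeries.mk (sf n)) ^ (d + 1)) := by
  induction d generalizing j with
  | zero =>
    simp only [zero_add, pow_one, coeff_mk]
    apply sf_rot; omega
  | succ d ih =>
    rw [sA_rec n hn _ j (by omega), pow_succ, coeff_mul,
      Finset.Nat.sum_antidiagonal_eq_sum_range_succ_mk]
    apply Finset.sum_congr rfl
    intro l _
    rw [show n - (d + 1) + 1 = n - d by omega, ih (by omega), coeff_mk]

open PowerSeries in
theorem sf_eq (n : ℕ) (hn : 1 ≤ n) :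
    (PowerSeries.mk (sf n)) = 1 + X * (PowerSeries.mk (sf n)) ^ (n + 1) := by
  ext m
  rcases m with _ | m
  · simp [sf, ncF_of_le]
  · rw [map_add, coeff_succ_X_mul, ← sA_pow n hn n le_rfl]
    simp [coeff_one, sf]
    rfl

/-- closed form -/
def fcE (p k : ℕ) : ℕ → ℤ
  | 0 => 1
  | m + 1 => ((m + 1) * p + k).choose (m + 1) - p * (((m + 1) * p + k - 1).choose m)

theorem fcE_zero (p m : ℕ) (hp : 1 ≤ p) : fcE p 0 (m + 1) = 0 := by
  simp only [fcE, add_zero]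
  obtain ⟨q, rfl⟩ : ∃ q, p = q + 1 := ⟨p - 1, by omega⟩
  have e : (m + 1) * (q + 1) = ((m + 1) * (q + 1) - 1) + 1 := by
    have : 0 < (m + 1) * (q + 1) := by positivity
    omega
  have := Nat.add_one_mul_choose_eq ((m + 1) * (q + 1) - 1) m
  rw [← e] at this
  have h2 : (((m + 1) * (q + 1) : ℕ) : ℤ).natAbs = (m + 1) * (q + 1) := rfl
  have h3 : ((m + 1 : ℕ) : ℤ) * ((q + 1 : ℕ) * (((m + 1) * (q + 1) - 1).choose m : ℕ)) =
     ((m + 1 : ℕ) : ℤ) * ((((m + 1) * (q + 1)).choose (m + 1) : ℕ) : ℤ) := by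
    exact_mod_cast (by linarith : (m + 1) * ((q + 1) * (((m + 1) * (q + 1) - 1).choose m)) =
      (m + 1) * (((m + 1) * (q + 1)).choose (m + 1)))
  have h4 := mul_left_cancel₀ (by positivity) h3
  rw [h4]; ring

theorem fcE_rec (p k m : ℕ) (hp : 1 ≤ p) :
    fcE p (k + 1) (m + 1) = fcE p k (m + 1) + fcE p (k + p) m := by
  have hpos : 0 < (m + 1) * p := by positivity
  rcases m with _ | m
  · simp [fcE]
  · simp only [fcE]
    have e1 : (m + 1 + 1) * p + (k + 1) = ((m + 1 + 1) * p + k) + 1 := by ring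
    have e2 : (m + 1) * p + (k + p) = (m + 1 + 1) * p + k := by ring
    have hh : 0 < (m + 1 + 1) * p := by positivity
    obtain ⟨M, hM⟩ : ∃ M, (m + 1 + 1) * p + k = M + 1 := ⟨(m + 1 + 1) * p + k - 1, by omega⟩
    rw [e1, e2, hM]
    simp only [Nat.add_sub_cancel]
    rw [Nat.choose_succ_succ (M + 1) (m + 1), Nat.choose_succ_succ M m]
    push_cast
    ring

open PowerSeries in
theorem pow_coeff (n : ℕ) (f : PowerSeries ℕ) (hf : f = 1 + X * f ^ (n + 1)) (m : ℕ) :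
    ∀ k, ((coeff m (f ^ k) : ℕ) : ℤ) = fcE (n + 1) k m := by
  induction m with
  | zero =>
    intro k
    have : constantCoeff f = 1 := by rw [hf]; simp
    simp [fcE, this]
  | succ m ih =>
    intro k
    induction k with
    | zero => rw [fcE_zero _ _ (by omega)]; simp [coeff_one]
    | succ k ihk =>
      rw [fcE_rec _ _ _ (by omega), ← ihk, ← ih]
      have : f ^ (k + 1) = f ^ k + X * f ^ (k + (n + 1)) := by
        calc f ^ (k + 1) = f ^ k * f := pow_succ _ _
          _ = f ^ k * (1 + X * f ^ (n + 1)) := by rw [← hf]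
          _ = _ := by ring
      rw [this, map_add, coeff_succ_X_mul]
      push_cast; rfl

theorem sf_closed (n m : ℕ) (hn : 1 ≤ n) (hm : 1 ≤ m) :
    m * sf n m = Nat.choose (m * (n + 1)) (m - 1) := by
  obtain ⟨m, rfl⟩ : ∃ q, m = q + 1 := ⟨m - 1, by omega⟩
  have h := pow_coeff n _ (sf_eq n hn) (m + 1) 1
  rw [pow_one, PowerSeries.coeff_mk] at h
  simp only [fcE, Nat.add_sub_cancel] at h ⊢
  have := Nat.add_one_mul_choose_eq ((m + 1) * (n + 1)) m
  zify at this ⊢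
  rw [h]
  push_cast at *
  linarith

/-- noncrossing colour-compatible involutions of the interval `[i,j)`. -/
structure IsNC (col : ℕ → Bool) (i j : ℕ) (σ : ℕ → ℕ) : Prop where
  out : ∀ x, x < i ∨ j ≤ x → σ x = x
  mem : ∀ x, i ≤ x → x < j → i ≤ σ x ∧ σ x < j
  inv : ∀ x, σ (σ x) = x
  ne : ∀ x, i ≤ x → x < j → col (σ x) ≠ col x
  nc : ∀ x y, x < y → y < σ x → σ y < σ x

theorem IsNC.nc' {col : ℕ → Bool} {i j : ℕ} {σ : ℕ → ℕ} (h : IsNC col i j σ)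
    {x y : ℕ} (h1 : x < y) (h2 : y < σ x) : x < σ y := by
  by_contra hc
  rcases Nat.lt_or_ge (σ y) x with h3 | h3
  · have := h.nc (σ y) x h3 (by rw [h.inv]; exact h1)
    rw [h.inv] at this
    omega
  · have : σ y = x := by omega
    have := h.inv y
    rw [‹σ y = x›] at this
    omega

/-- gluing -/
def ncGlue (i k : ℕ) (τ ρ : ℕ → ℕ) (x : ℕ) : ℕ :=
  if x = i then k else if x = k then i else if x < k then τ x else ρ x

theorem ncGlue_isNC {col : ℕ → Bool} {i j k : ℕ} (hik : i < k) (hkj : k < j)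
    (hc : col i ≠ col k) {τ ρ : ℕ → ℕ} (hτ : IsNC col (i + 1) k τ) (hρ : IsNC col (k + 1) j ρ) :
    IsNC col i j (ncGlue i k τ ρ) := by
  have key : ∀ x, (x < i ∧ ncGlue i k τ ρ x = x) ∨ (x = i ∧ ncGlue i k τ ρ x = k) ∨
      (x = k ∧ ncGlue i k τ ρ x = i) ∨
      (i < x ∧ x < k ∧ i < τ x ∧ τ x < k ∧ ncGlue i k τ ρ x = τ x) ∨
      (k < x ∧ x < j ∧ k < ρ x ∧ ρ x < j ∧ ncGlue i k τ ρ x = ρ x) ∨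
      (j ≤ x ∧ ncGlue i k τ ρ x = x) := by
    intro x
    have a1 := hτ.out x
    have a2 := hτ.mem x
    have b1 := hρ.out x
    have b2 := hρ.mem x
    unfold ncGlue
    split_ifs <;> omega
  have gl : ∀ x, i < x → x < k → ncGlue i k τ ρ x = τ x := by
    intro x h1 h2; have := key x; omega
  have gr : ∀ x, k < x → x < j → ncGlue i k τ ρ x = ρ x := by
    intro x h1 h2; have := key x; omega
  have gi : ncGlue i k τ ρ i = k := by have := key i; omega
  have gk : ncGlue i k τ ρ k = i := by have := key k; omega
  refine ⟨?_, ?_, ?_, ?_, ?_⟩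
  · intro x hx; have := key x; omega
  · intro x h1 h2; have := key x; omega
  · intro x
    rcases key x with h | h | h | h | h | h
    · rw [h.2, h.2]
    · rw [h.2, gk, h.1]
    · rw [h.2, gi, h.1]
    · obtain ⟨h1, h2, h3, h4, h5⟩ := h
      rw [h5, gl _ h3 h4, hτ.inv]
    · obtain ⟨h1, h2, h3, h4, h5⟩ := h
      rw [h5, gr _ h3 h4, hρ.inv]
    · rw [h.2, h.2]
  · intro x hx1 hx2
    rcases key x with h | h | h | h | h | h
    · omega
    · rw [h.2, h.1]; exact hc.symm
    · rw [h.2, h.1]; exact hc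
    · rw [h.2.2.2.2]; exact hτ.ne x (by omega) (by omega)
    · rw [h.2.2.2.2]; exact hρ.ne x (by omega) (by omega)
    · omega
  · intro x y h1 h2
    have a := hτ.nc x y h1
    have b := hρ.nc x y h1
    have kx := key x
    have ky := key y
    omega

theorem ncGlue_surj {col : ℕ → Bool} {i j : ℕ} (hij : i < j) {σ : ℕ → ℕ} (h : IsNC col i j σ) :
    i < σ i ∧ σ i < j ∧ col i ≠ col (σ i) ∧
      IsNC col (i + 1) (σ i) (fun x => if i < x ∧ x < σ i then σ x else x) ∧
      IsNC col (σ i + 1) j (fun x => if σ i < x then σ x else x) ∧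
      ncGlue i (σ i) (fun x => if i < x ∧ x < σ i then σ x else x)
        (fun x => if σ i < x then σ x else x) = σ := by
  have hm := h.mem i le_rfl hij
  have hcn := h.ne i le_rfl hij
  have hne : σ i ≠ i := fun e => hcn (by rw [e])
  have hlt : i < σ i := by omega
  have inner : ∀ x, i < x → x < σ i → i < σ x ∧ σ x < σ i := fun x h1 h2 =>
    ⟨h.nc' h1 h2, h.nc i x h1 h2⟩
  have hii := h.inv i
  have outer : ∀ x, σ i < x → σ i < σ x := by
    intro x hx
    have hx2 := h.inv x
    rcases Nat.lt_or_ge x j with hj | hj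
    · have := h.mem x (by omega) hj
      by_contra hc
      rcases Nat.lt_or_ge i (σ x) with h3 | h3
      · rcases Nat.lt_or_ge (σ x) (σ i) with h4 | h4
        · have := inner _ h3 h4; omega
        · have e : σ x = σ i := by omega
          rw [e] at hx2; omega
      · have e : σ x = i := by omega
        rw [e] at hx2; omega
    · rw [h.out x (Or.inr hj)]; exact hx
  refine ⟨hlt, hm.2, hcn.symm, ⟨?_, ?_, ?_, ?_, ?_⟩, ⟨?_, ?_, ?_, ?_, ?_⟩, ?_⟩
  · intro x hx; rw [if_neg (by omega)]
  · intro x h1 h2; rw [if_pos (by omega)]; have := inner x (by omega) h2; omega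
  · intro x
    by_cases hx : i < x ∧ x < σ i
    · simp only [if_pos hx, if_pos (inner x hx.1 hx.2), h.inv]
    · simp only [if_neg hx]
  · intro x h1 h2; rw [if_pos (by omega)]; exact h.ne x (by omega) (by omega)
  · intro x y hxy hy
    have := h.nc x y hxy
    have := inner x
    split_ifs at hy ⊢ <;> omega
  · intro x hx
    split_ifs with hh
    · exact h.out x (by omega)
    · rfl
  · intro x h1 h2; rw [if_pos (by omega)]
    have := outer x (by omega); have := h.mem x (by omega) h2; omega
  · intro x
    by_cases hx : σ i < x
    · simp only [if_pos hx, if_pos (outer x hx), h.inv]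
    · simp only [if_neg hx]
  · intro x h1 h2; rw [if_pos (by omega)]; exact h.ne x (by omega) (by omega)
  · intro x y hxy hy
    have := h.nc x y hxy
    split_ifs at hy ⊢ <;> omega
  · funext x
    unfold ncGlue
    by_cases e1 : x = i
    · rw [if_pos e1, e1]
    by_cases e2 : x = σ i
    · rw [if_neg e1, if_pos e2, e2, hii]
    rw [if_neg e1, if_neg e2]
    by_cases h1 : x < σ i
    · rw [if_pos h1]
      by_cases h2 : i < x
      · simp only [h1, h2, and_self, if_true]
      · simp only [h2, false_and, if_false]
        exact (h.out x (by omega)).symm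
    · rw [if_neg h1]
      simp only [show σ i < x by omega, if_true]

theorem ncGlue_inj {col : ℕ → Bool} {i j k : ℕ} (hik : i < k) {τ ρ τ' ρ' : ℕ → ℕ}
    (hτ : IsNC col (i + 1) k τ) (hρ : IsNC col (k + 1) j ρ)
    (hτ' : IsNC col (i + 1) k τ') (hρ' : IsNC col (k + 1) j ρ')
    (he : ncGlue i k τ ρ = ncGlue i k τ' ρ') : τ = τ' ∧ ρ = ρ' := by
  constructor
  · funext x
    have h0 := congrFun he x
    by_cases h : i < x ∧ x < k
    · simpa [ncGlue, show x ≠ i by omega, show x ≠ k by omega, h.2] using h0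
    · rw [hτ.out x (by omega), hτ'.out x (by omega)]
  · funext x
    have h0 := congrFun he x
    by_cases h : k < x
    · simpa [ncGlue, show x ≠ i by omega, show x ≠ k by omega, show ¬ x < k by omega] using h0
    · rw [hρ.out x (by omega), hρ'.out x (by omega)]

theorem ncCard (col : ℕ → Bool) (L : ℕ) : ∀ i j, j - i = L →
    Finite {σ // IsNC col i j σ} ∧ Nat.card {σ // IsNC col i j σ} = ncF col i j := by
  induction L using Nat.strong_induction_on with
  | _ L ih =>
    intro i j hL
    rcases Nat.lt_or_ge i j with hij | hij
    · have fin1 : ∀ k : ((Finset.Ioo i j).filter (fun k => col i ≠ col k)),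
          Finite ({σ // IsNC col (i + 1) k.1 σ} × {σ // IsNC col (k.1 + 1) j σ}) := by
        intro k
        have hk := Finset.mem_Ioo.1 (Finset.mem_filter.1 k.2).1
        have := (ih (k.1 - (i + 1)) (by omega) (i + 1) k.1 rfl).1
        have := (ih (j - (k.1 + 1)) (by omega) (k.1 + 1) j rfl).1
        infer_instance
      let G : (Σ k : ((Finset.Ioo i j).filter (fun k => col i ≠ col k)),
          {σ // IsNC col (i + 1) k.1 σ} × {σ // IsNC col (k.1 + 1) j σ}) →
          {σ // IsNC col i j σ} := fun t =>
        ⟨ncGlue i t.1.1 t.2.1.1 t.2.2.1, by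
          have hk := Finset.mem_filter.1 t.1.2
          have hk1 := Finset.mem_Ioo.1 hk.1
          exact ncGlue_isNC hk1.1 hk1.2 hk.2 t.2.1.2 t.2.2.2⟩
      have hG : Function.Bijective G := by
        constructor
        · rintro ⟨⟨k, hk⟩, ⟨τ, hτ⟩, ⟨ρ, hρ⟩⟩ ⟨⟨k', hk'⟩, ⟨τ', hτ'⟩, ⟨ρ', hρ'⟩⟩ he
          have he' : ncGlue i k τ ρ = ncGlue i k' τ' ρ' := congrArg Subtype.val he
          have hkk : k = k' := by
            have := congrFun he' i
            simpa [ncGlue] using this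
          subst hkk
          have hk1 := Finset.mem_Ioo.1 (Finset.mem_filter.1 hk).1
          obtain ⟨e1, e2⟩ := ncGlue_inj hk1.1 hτ hρ hτ' hρ' he'
          subst e1 e2
          rfl
        · rintro ⟨σ, hσ⟩
          obtain ⟨h1, h2, h3, h4, h5, h6⟩ := ncGlue_surj hij hσ
          refine ⟨⟨⟨σ i, Finset.mem_filter.2 ⟨Finset.mem_Ioo.2 ⟨h1, h2⟩, h3⟩⟩, ⟨_, h4⟩, ⟨_, h5⟩⟩, ?_⟩
          exact Subtype.ext h6
      refine ⟨Finite.of_surjective G hG.2, ?_⟩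
      rw [← Nat.card_eq_of_bijective G hG, Nat.card_sigma, ncF_left col hij]
      rw [Finset.sum_coe_sort ((Finset.Ioo i j).filter (fun k => col i ≠ col k))
        (fun k => Nat.card ({σ // IsNC col (i + 1) k σ} × {σ // IsNC col (k + 1) j σ})),
        Finset.sum_filter]
      apply Finset.sum_congr rfl
      intro k hk
      rw [Finset.mem_Ioo] at hk
      rw [Nat.card_prod, (ih (k - (i + 1)) (by omega) (i + 1) k rfl).2,
        (ih (j - (k + 1)) (by omega) (k + 1) j rfl).2]
      unfold ncW
      by_cases hc : col i = col k <;> simp [hc]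
    · have hid : IsNC col i j id := ⟨fun _ _ => rfl, fun x _ _ => by omega, fun _ => rfl,
        fun x _ _ => by omega, fun x y h1 h2 => by simp at h2; omega⟩
      have : Unique {σ // IsNC col i j σ} :=
        { default := ⟨id, hid⟩
          uniq := fun σ => Subtype.ext (funext fun x => σ.2.out x (by omega)) }
      refine ⟨inferInstance, ?_⟩
      rw [ncF_of_le col hij, Nat.card_unique]

/-- the setoid of an involution -/
def invSetoid (N : ℕ) (σ : ℕ → ℕ) (h : ∀ x, σ (σ x) = x) : Setoid (Fin N) where
  r p q := q.val = p.val ∨ q.val = σ p.val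
  iseqv := by
    refine ⟨fun _ => Or.inl rfl, ?_, ?_⟩
    · rintro p q (e | e)
      · exact Or.inl e.symm
      · right; rw [e, h]
    · rintro p q r (e | e) (e' | e')
      · left; rw [e', e]
      · right; rw [e', e]
      · right; rw [e', e]
      · left; rw [e', e, h]

theorem invSetoid_star (n m : ℕ) (hn : 1 ≤ n) (σ : ℕ → ℕ) (h : IsNC (scol n) 0 (2 * n * m) σ) :
    IsStarPairing n m (invSetoid (2 * n * m) σ h.inv) := by
  refine ⟨?_, ?_, ?_⟩
  · rintro ⟨p, q, p', q', h1, h2, h3, h4, h5, h6⟩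
    change p'.val = p.val ∨ p'.val = σ p.val at h4
    change q'.val = q.val ∨ q'.val = σ q.val at h5
    rw [Fin.lt_def] at h1 h2 h3
    have e1 : p'.val = σ p.val := by omega
    have e2 : q'.val = σ q.val := by omega
    have := h.nc p.val q.val h1 (by omega)
    omega
  · intro p
    have hm := h.mem p.val (by omega) p.2
    have hne := h.ne p.val (by omega) p.2
    refine ⟨⟨σ p.val, hm.2⟩, ⟨?_, Or.inr rfl⟩, ?_⟩
    · intro e
      apply hne
      exact congrArg (scol n) (congrArg Fin.val e)
    · rintro q ⟨hq, e | e⟩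
      · exact absurd (Fin.ext e) hq
      · exact Fin.ext e
  · rintro p q hpq (e | e)
    · exact absurd (Fin.ext e.symm) hpq
    · have hne := h.ne p.val (by omega) p.2
      rw [← e] at hne
      unfold IsCPos
      rw [← scol_iff n _ hn, ← scol_iff n _ hn]
      revert hne
      cases scol n p.val <;> cases scol n q.val <;> simp

theorem star_surj (n m : ℕ) (hn : 1 ≤ n) (π : Setoid (Fin (2 * n * m))) (h : IsStarPairing n m π) :
    ∃ σ, ∃ hσ : IsNC (scol n) 0 (2 * n * m) σ, invSetoid (2 * n * m) σ hσ.inv = π := by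
  obtain ⟨hnc, hpp, hcol⟩ := h
  choose g hg hu using hpp
  simp only at hg hu
  have gg : ∀ p, g (g p) = p := by
    intro p
    exact (hu (g p) p ⟨(hg p).1.symm, π.symm (hg p).2⟩).symm
  let σ : ℕ → ℕ := fun x => if hx : x < 2 * n * m then (g ⟨x, hx⟩).val else x
  have s1 : ∀ p : Fin (2 * n * m), σ p.val = (g p).val := by
    intro p; simp [σ]
  have s2 : ∀ x, ¬ x < 2 * n * m → σ x = x := by
    intro x hx; simp [σ, hx]
  have hσ : IsNC (scol n) 0 (2 * n * m) σ := by
    refine ⟨?_, ?_, ?_, ?_, ?_⟩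
    · intro x hx; exact s2 x (by omega)
    · intro x _ hx
      rw [s1 ⟨x, hx⟩]; exact ⟨by omega, (g ⟨x, hx⟩).2⟩
    · intro x
      by_cases hx : x < 2 * n * m
      · rw [s1 ⟨x, hx⟩, s1, gg]
      · rw [s2 x hx, s2 x hx]
    · intro x _ hx e
      rw [s1 ⟨x, hx⟩] at e
      have := hcol ⟨x, hx⟩ (g ⟨x, hx⟩) (hg _).1.symm (hg _).2
      unfold IsCPos at this
      rw [← scol_iff n _ hn, ← scol_iff n _ hn, e] at this
      simp at this
    · intro x y hxy hy
      by_cases hx : x < 2 * n * m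
      · rw [s1 ⟨x, hx⟩] at hy ⊢
        have hy2 : y < 2 * n * m := lt_trans hy (g ⟨x, hx⟩).2
        rw [s1 ⟨y, hy2⟩]
        by_contra hc
        have hgy : g ⟨y, hy2⟩ ≠ g ⟨x, hx⟩ := by
          intro e
          have := congrArg g e
          rw [gg, gg] at this
          have := congrArg Fin.val this
          simp only at this
          omega
        have hgy' : (g ⟨y, hy2⟩).val ≠ (g ⟨x, hx⟩).val := fun e => hgy (Fin.ext e)
        apply hnc
        refine ⟨⟨x, hx⟩, ⟨y, hy2⟩, g ⟨x, hx⟩, g ⟨y, hy2⟩, hxy, hy, ?_, (hg _).2, (hg _).2, ?_⟩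
        · rw [Fin.lt_def]; omega
        · intro hr
          have := hu ⟨x, hx⟩ ⟨y, hy2⟩ ⟨by intro e; have := congrArg Fin.val e; simp only at this; omega, hr⟩
          have := congrArg Fin.val this
          simp only at this
          omega
      · rw [s2 x hx] at hy; omega
  refine ⟨σ, hσ, ?_⟩
  ext p q
  change (q.val = p.val ∨ q.val = σ p.val) ↔ π.r p q
  rw [s1]
  constructor
  · rintro (e | e)
    · rw [Fin.ext e]
    · rw [Fin.ext e]; exact (hg p).2
  · intro hr
    by_cases e : q = p
    · left; rw [e]
    · right; rw [hu p q ⟨e, hr⟩]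

theorem star_ncard (n m : ℕ) (hn : 1 ≤ n) :
    Set.ncard {π : Setoid (Fin (2 * n * m)) | IsStarPairing n m π} = sf n m := by
  unfold sf
  rw [← (ncCard (scol n) _ 0 (2 * n * m) rfl).2, ← Nat.card_coe_set_eq]
  symm
  apply Nat.card_eq_of_bijective (fun σ : {σ // IsNC (scol n) 0 (2 * n * m) σ} =>
    (⟨invSetoid (2 * n * m) σ.1 σ.2.inv, invSetoid_star n m hn σ.1 σ.2⟩ :
      {π : Setoid (Fin (2 * n * m)) | IsStarPairing n m π}))
  constructor
  · rintro ⟨σ, hσ⟩ ⟨τ, hτ⟩ he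
    have he' : invSetoid (2 * n * m) σ hσ.inv = invSetoid (2 * n * m) τ hτ.inv :=
      congrArg Subtype.val he
    apply Subtype.ext
    funext x
    change σ x = τ x
    by_cases hx : x < 2 * n * m
    · have hm := hσ.mem x (by omega) hx
      have h1 : (invSetoid (2 * n * m) σ hσ.inv).r ⟨x, hx⟩ ⟨σ x, hm.2⟩ := Or.inr rfl
      rw [he'] at h1
      rcases h1 with e | e
      · exact absurd (congrArg (scol n) e) (hσ.ne x (by omega) hx)
      · exact e
    · rw [hσ.out x (by omega), hτ.out x (by omega)]
  · rintro ⟨π, hπ⟩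
    obtain ⟨σ, hσ, e⟩ := star_surj n m hn π hπ
    exact ⟨⟨σ, hσ⟩, Subtype.ext e⟩

/-- Enumeration of `NC₂*(n,m)`: the number of noncrossing ∗-pairings equals the
Fuss–Catalan number `C^{(n)}_m = (1/m)·binom(m(n+1), m−1)`; equivalently
`m · |NC₂*(n,m)| = binom(m(n+1), m−1)`. -/
theorem starPairing_card_fussCatalan (n m : ℕ) (hn : 1 ≤ n) (hm : 1 ≤ m) :
    m * Set.ncard {π : Setoid (Fin (2 * n * m)) | IsStarPairing n m π} =
      Nat.choose (m * (n + 1)) (m - 1) := by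
  rw [star_ncard n m hn, sf_closed n m hn hm]
end

section
/- Let k ≥ 2 and consider the operator A on square-summable functions g : FreeGroup (Fin k) → ℂ defined by (A g)(x) = ∑_{i < k} g((FreeGroup.of i)⁻¹ · x). Then A is bounded on ℓ²(FreeGroup (Fin k)) and its operator norm equals 2·√(k − 1). -/
namespace FGNorm

open Finset

/-- Prepending a generator to a word that does not start with its inverse. -/
lemma toWord_of_mul {k : ℕ} (i : Fin k) (y : FreeGroup (Fin k))
    (h : y.toWord.head? ≠ some (i, false)) :
    (FreeGroup.of i * y).toWord = (i, true) :: y.toWord := by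
  have hy : FreeGroup.IsReduced y.toWord := FreeGroup.isReduced_toWord
  rw [FreeGroup.toWord_mul, FreeGroup.toWord_of]
  apply FreeGroup.IsReduced.reduce_eq
  cases hw : y.toWord with
  | nil => simp
  | cons p L =>
    rw [hw] at h hy
    obtain ⟨j, b⟩ := p
    simp only [List.cons_append, List.nil_append]
    rw [FreeGroup.isReduced_cons_cons]
    refine ⟨?_, hy⟩
    rintro rfl
    cases b <;> simp_all

lemma sum_ite_le {k : ℕ} (hk : 2 ≤ k) (r : ℝ) (hr : 1 ≤ r) (hrk : r ^ 2 = (k : ℝ) - 1)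
    (P : Fin k → Prop) [DecidablePred P] (hP : ∀ i j, P i → P j → i = j) :
    ∑ i, (if P i then r else r⁻¹) ≤ 2 * r := by
  have hr0 : 0 < r := by linarith
  have hinv : r⁻¹ ≤ 1 := inv_le_one_of_one_le₀ hr
  obtain ⟨i0, hi0⟩ : ∃ i0 : Fin k, ∀ i, P i → i = i0 := by
    by_cases h : ∃ i, P i
    · obtain ⟨i0, h0⟩ := h
      exact ⟨i0, fun i hi => hP _ _ hi h0⟩
    · push Not at h
      exact ⟨⟨0, by omega⟩, fun i hi => absurd hi (h i)⟩
  calc ∑ i, (if P i then r else r⁻¹)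
      ≤ ∑ i, (r⁻¹ + if i = i0 then r - r⁻¹ else 0) := by
        apply Finset.sum_le_sum
        intro i _
        by_cases h : P i
        · rw [if_pos h, if_pos (hi0 i h)]; linarith
        · simp only [h, if_false]
          split_ifs <;> linarith
    _ = k * r⁻¹ + (r - r⁻¹) := by
        rw [Finset.sum_add_distrib]; simp
    _ = 2 * r := by
        have : (k : ℝ) = r ^ 2 + 1 := by linarith
        rw [this]; field_simp; ring

/-- Edge weights for the Schur test. -/
noncomputable def wt {k : ℕ} (r : ℝ) (i : Fin k) (x : FreeGroup (Fin k)) : ℝ :=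
  if x.toWord.head? = some (i, true) then r else r⁻¹

lemma wt_pos {k : ℕ} {r : ℝ} (hr : 1 ≤ r) (i : Fin k) (x : FreeGroup (Fin k)) :
    0 < wt r i x := by
  have hr0 : 0 < r := by linarith
  unfold wt
  split_ifs <;> positivity

lemma sum_wt_le {k : ℕ} (hk : 2 ≤ k) (r : ℝ) (hr : 1 ≤ r) (hrk : r ^ 2 = (k : ℝ) - 1)
    (x : FreeGroup (Fin k)) : ∑ i, wt r i x ≤ 2 * r := by
  apply sum_ite_le hk r hr hrk
  intro i j hi hj
  simp_all

lemma inv_wt_le {k : ℕ} {r : ℝ} (hr : 1 ≤ r) (i : Fin k) (x : FreeGroup (Fin k)) :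
    (wt r i x)⁻¹ ≤ r := by
  have hinv : r⁻¹ ≤ 1 := inv_le_one_of_one_le₀ hr
  unfold wt
  split_ifs
  · linarith
  · simp

lemma sum_inv_wt_le {k : ℕ} (hk : 2 ≤ k) (r : ℝ) (hr : 1 ≤ r) (hrk : r ^ 2 = (k : ℝ) - 1)
    (y : FreeGroup (Fin k)) : ∑ i, (wt r i (FreeGroup.of i * y))⁻¹ ≤ 2 * r := by
  refine le_trans (Finset.sum_le_sum (g := fun i =>
    if y.toWord.head? = some (i, false) then r else r⁻¹) ?_) ?_
  · intro i _
    split_ifs with h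
    · exact inv_wt_le hr _ _
    · rw [wt, toWord_of_mul i y h]; simp
  · apply sum_ite_le hk r hr hrk
    intro i j hi hj
    simp_all

lemma upper {k : ℕ} (hk : 2 ≤ k) (r : ℝ) (hr : 1 ≤ r) (hrk : r ^ 2 = (k : ℝ) - 1)
    (g : FreeGroup (Fin k) → ℂ) (hg : Summable (fun x => ‖g x‖ ^ 2)) :
    Summable (fun x => ‖∑ i : Fin k, g ((FreeGroup.of i)⁻¹ * x)‖ ^ 2) ∧
    ∑' x, ‖∑ i : Fin k, g ((FreeGroup.of i)⁻¹ * x)‖ ^ 2 ≤ (2 * r) ^ 2 * ∑' x, ‖g x‖ ^ 2 := by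
  have hr0 : 0 < r := by linarith
  set B : Fin k → FreeGroup (Fin k) → ℝ :=
    fun i x => ‖g ((FreeGroup.of i)⁻¹ * x)‖ ^ 2 * (wt r i x)⁻¹ with hB
  have hBy : ∀ i y, B i (FreeGroup.of i * y) =
      ‖g y‖ ^ 2 * (wt r i (FreeGroup.of i * y))⁻¹ := by
    intro i y; simp [hB]
  have hS' : ∀ i, Summable (fun y => ‖g y‖ ^ 2 * (wt r i (FreeGroup.of i * y))⁻¹) := by
    intro i
    refine Summable.of_nonneg_of_le (fun y => ?_) (fun y => ?_) (hg.mul_right r)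
    · have := wt_pos hr i (FreeGroup.of i * y); positivity
    · exact mul_le_mul_of_nonneg_left (inv_wt_le hr _ _) (by positivity)
  have hS : ∀ i, Summable (B i) := by
    intro i
    rw [← (Equiv.mulLeft (FreeGroup.of i)).summable_iff]
    refine (hS' i).congr (fun y => ?_)
    exact (hBy i y).symm
  have hT : ∀ i, ∑' x, B i x = ∑' y, ‖g y‖ ^ 2 * (wt r i (FreeGroup.of i * y))⁻¹ := by
    intro i
    rw [← (Equiv.mulLeft (FreeGroup.of i)).tsum_eq]
    exact tsum_congr (fun y => hBy i y)
  have hpt : ∀ x, ‖∑ i : Fin k, g ((FreeGroup.of i)⁻¹ * x)‖ ^ 2 ≤ 2 * r * ∑ i, B i x := by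
    intro x
    have hB0 : ∀ i, 0 ≤ B i x := fun i => by
      have := wt_pos hr i x
      simp only [hB]; positivity
    calc ‖∑ i : Fin k, g ((FreeGroup.of i)⁻¹ * x)‖ ^ 2
        ≤ (∑ i : Fin k, ‖g ((FreeGroup.of i)⁻¹ * x)‖) ^ 2 := by
          gcongr; exact norm_sum_le _ _
      _ ≤ (∑ i, wt r i x) * ∑ i, B i x := by
          apply Finset.sum_sq_le_sum_mul_sum_of_sq_le_mul
          · intro i _; exact (wt_pos hr i x).le
          · intro i _; exact hB0 i
          · intro i _
            have := wt_pos hr i x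
            simp only [hB]
            apply le_of_eq
            field_simp
      _ ≤ 2 * r * ∑ i, B i x := by
          apply mul_le_mul_of_nonneg_right (sum_wt_le hk r hr hrk x)
          exact Finset.sum_nonneg fun i _ => hB0 i
  have hSB : Summable (fun x => 2 * r * ∑ i, B i x) :=
    (summable_sum (fun i _ => hS i)).mul_left _
  have hSA := Summable.of_nonneg_of_le (fun x => by positivity) hpt hSB
  refine ⟨hSA, ?_⟩
  calc _ ≤ ∑' x, 2 * r * ∑ i, B i x := hSA.tsum_le_tsum hpt hSB
    _ = 2 * r * ∑ i, ∑' x, B i x := by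
        rw [tsum_mul_left, Summable.tsum_finsetSum (fun i _ => hS i)]
    _ = 2 * r * ∑' y, ∑ i, ‖g y‖ ^ 2 * (wt r i (FreeGroup.of i * y))⁻¹ := by
        rw [Summable.tsum_finsetSum (fun i _ => hS' i)]
        simp only [hT]
    _ ≤ 2 * r * ∑' y, ‖g y‖ ^ 2 * (2 * r) := by
        refine mul_le_mul_of_nonneg_left ?_ (by positivity)
        refine Summable.tsum_le_tsum (fun y => ?_) (summable_sum (fun i _ => hS' i))
          (hg.mul_right _)
        rw [← Finset.mul_sum]
        exact mul_le_mul_of_nonneg_left (sum_inv_wt_le hk r hr hrk y) (by positivity)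
    _ = _ := by rw [tsum_mul_right]; ring

/-- Alternating-sign word with the given indices. -/
def wd {k : ℕ} : Bool → List (Fin k) → List (Fin k × Bool)
  | _, [] => []
  | b, i :: l => (i, b) :: wd (!b) l

lemma wd_length {k : ℕ} (l : List (Fin k)) : ∀ b, (wd b l).length = l.length := by
  induction l with
  | nil => intro b; rfl
  | cons i l ih => intro b; simp [wd, ih]

lemma wd_inj {k : ℕ} (l : List (Fin k)) : ∀ b l', wd b l = wd b l' → l = l' := by
  induction l with
  | nil => intro b l' h; cases l' <;> simp_all [wd]
  | cons i l ih =>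
    intro b l' h
    cases l' with
    | nil => simp [wd] at h
    | cons j l' =>
      simp only [wd, List.cons.injEq, Prod.mk.injEq, and_true] at h
      rw [h.1, ih _ _ h.2]

lemma wd_red {k : ℕ} (l : List (Fin k)) (hl : l.IsChain (· ≠ ·)) :
    ∀ b, FreeGroup.IsReduced (wd b l) := by
  induction l with
  | nil => intro b; simp [wd]
  | cons i l ih =>
    intro b
    cases l with
    | nil => simp [wd]
    | cons j l =>
      rw [List.isChain_cons_cons] at hl
      have := ih hl.2 (!b)
      simp only [wd] at this ⊢
      rw [FreeGroup.isReduced_cons_cons]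
      exact ⟨fun h => absurd h hl.1, this⟩

/-- The group element of an alternating word. -/
def el {k : ℕ} (b : Bool) (l : List (Fin k)) : FreeGroup (Fin k) := FreeGroup.mk (wd b l)

lemma toWord_el {k : ℕ} (b : Bool) (l : List (Fin k)) (hl : l.IsChain (· ≠ ·)) :
    (el b l).toWord = wd b l := by
  rw [el, FreeGroup.toWord_mk, (wd_red l hl b).reduce_eq]

lemma inv_mul_el_same {k : ℕ} (i : Fin k) (l : List (Fin k)) :
    (FreeGroup.of i)⁻¹ * el true (i :: l) = el false l := by
  rw [inv_mul_eq_iff_eq_mul]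
  simp [el, wd, FreeGroup.of, FreeGroup.mul_mk]

lemma inv_mul_el {k : ℕ} (j : Fin k) (l : List (Fin k)) :
    (FreeGroup.of j)⁻¹ * el true l = el false (j :: l) := by
  simp [el, wd, FreeGroup.of, FreeGroup.mul_mk, FreeGroup.inv_mk, FreeGroup.invRev]

/-- Index lists of length `n+1` ending in `o` with distinct neighbours. -/
def C {k : ℕ} (o : Fin k) : ℕ → Finset (List (Fin k))
  | 0 => {[o]}
  | n + 1 => (C o n).biUnion fun l =>
      (univ.filter fun i => l.head? ≠ some i).image (fun i => i :: l)

lemma mem_C_succ {k : ℕ} (o : Fin k) (n : ℕ) (l : List (Fin k)) :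
    l ∈ C o (n + 1) ↔ ∃ l' ∈ C o n, ∃ i, l'.head? ≠ some i ∧ i :: l' = l := by
  simp [C]

lemma mem_C {k : ℕ} (o : Fin k) (n : ℕ) : ∀ l ∈ C o n,
    l.length = n + 1 ∧ l.IsChain (· ≠ ·) := by
  induction n with
  | zero => intro l hl; simp [C] at hl; simp [hl]
  | succ n ih =>
    intro l hl
    rw [mem_C_succ] at hl
    obtain ⟨l', hl', i, hi, rfl⟩ := hl
    obtain ⟨h1, h2⟩ := ih l' hl'
    refine ⟨by simp [h1], ?_⟩
    cases l' with
    | nil => simp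
    | cons j l' =>
      rw [List.isChain_cons_cons]
      refine ⟨?_, h2⟩
      rintro rfl
      simp at hi

lemma card_C {k : ℕ} (o : Fin k) (n : ℕ) : (C o n).card = (k - 1) ^ n := by
  induction n with
  | zero => simp [C]
  | succ n ih =>
    rw [C, Finset.card_biUnion]
    · rw [Finset.sum_congr rfl (g := fun _ => k - 1), Finset.sum_const, ih, pow_succ, smul_eq_mul]
      intro l hl
      rw [Finset.card_image_of_injective _ (fun a b h => by simpa using h)]
      have := (mem_C o n l hl).1
      cases l with
      | nil => simp at this
      | cons j l =>
        have : (univ.filter fun i => (j :: l).head? ≠ some i) = univ.erase j := by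
          ext i; simp [eq_comm]
        rw [this, Finset.card_erase_of_mem (mem_univ _)]
        simp
    · intro l _ l' _ hne
      rw [Function.onFun, Finset.disjoint_left]
      intro a ha hb
      simp only [mem_image] at ha hb
      obtain ⟨i, _, rfl⟩ := ha
      obtain ⟨j, _, h⟩ := hb
      simp at h
      exact hne h.2.symm

lemma C_disj {k : ℕ} (o : Fin k) {m n : ℕ} (h : m ≠ n) : Disjoint (C o m) (C o n) := by
  rw [Finset.disjoint_left]
  intro l h1 h2
  have := (mem_C o m l h1).1
  have := (mem_C o n l h2).1
  omega

/-- The support of the test function. -/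
def F {k : ℕ} (o : Fin k) (N : ℕ) : Finset (FreeGroup (Fin k)) :=
  ((range (N + 1)).biUnion fun m => C o (2 * m + 1)).image (el false)

/-- The test function. -/
noncomputable def tf {k : ℕ} (s : ℝ) (o : Fin k) (N : ℕ) (y : FreeGroup (Fin k)) : ℝ :=
  if y ∈ F o N then s ^ y.toWord.length else 0

lemma tf_el {k : ℕ} (s : ℝ) (o : Fin k) (N m : ℕ) (hm : m ≤ N) (l : List (Fin k))
    (hl : l ∈ C o (2 * m + 1)) : tf s o N (el false l) = s ^ (2 * m + 2) := by
  have hF : el false l ∈ F o N := by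
    apply Finset.mem_image_of_mem
    rw [Finset.mem_biUnion]
    exact ⟨m, by simp; omega, hl⟩
  obtain ⟨h1, h2⟩ := mem_C o _ l hl
  rw [tf, if_pos hF, toWord_el _ _ h2, wd_length, h1]

lemma inj_el {k : ℕ} (b : Bool) (S : Set (List (Fin k))) (hS : ∀ l ∈ S, l.IsChain (· ≠ ·)) :
    Set.InjOn (el b) S := by
  intro l hl l' hl' h
  apply wd_inj l b
  rw [← toWord_el b l (hS l hl), ← toWord_el b l' (hS l' hl'), h]

lemma tf_norm {k : ℕ} (hk : 2 ≤ k) (s : ℝ) (hs : s ^ 2 * ((k : ℝ) - 1) = 1) (o : Fin k) (N : ℕ) :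
    ∑ y ∈ F o N, (tf s o N y) ^ 2 = (N + 1) * s ^ 2 := by
  rw [F, Finset.sum_image, Finset.sum_biUnion]
  · rw [Finset.sum_congr rfl (g := fun _ => s ^ 2)]
    · simp
    · intro m hm
      rw [Finset.sum_congr rfl (g := fun _ => (s ^ (2 * m + 2)) ^ 2)]
      · rw [Finset.sum_const, card_C, nsmul_eq_mul]
        push_cast [Nat.cast_sub (show 1 ≤ k by omega)]
        calc ((k : ℝ) - 1) ^ (2 * m + 1) * (s ^ (2 * m + 2)) ^ 2
            = (s ^ 2 * ((k : ℝ) - 1)) ^ (2 * m + 1) * s ^ 2 := by rw [mul_pow (s ^ 2)]; ring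
          _ = s ^ 2 := by rw [hs]; simp
      · intro l hl
        rw [tf_el s o N m (by simp at hm; omega) l hl]
  · intro m _ n _ h
    exact C_disj o (by omega)
  · apply inj_el
    intro l hl
    simp only [coe_biUnion, Set.mem_iUnion] at hl
    obtain ⟨m, _, hl⟩ := hl
    exact (mem_C o _ l hl).2

lemma tf_A {k : ℕ} (s : ℝ) (hs : s ^ 2 * ((k : ℝ) - 1) = 1) (o : Fin k)
    (N m : ℕ) (hm : m < N) (l : List (Fin k)) (hl : l ∈ C o (2 * m + 2)) :
    ∑ j, tf s o N ((FreeGroup.of j)⁻¹ * el true l) = 2 * s ^ (2 * m + 2) := by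
  have hl0 := hl
  rw [mem_C_succ] at hl
  obtain ⟨l', hl', i, hi, rfl⟩ := hl
  have h1 : ∀ j, tf s o N ((FreeGroup.of j)⁻¹ * el true (i :: l')) =
      s ^ (2 * m + 4) + if j = i then s ^ (2 * m + 2) - s ^ (2 * m + 4) else 0 := by
    intro j
    by_cases hj : j = i
    · subst hj
      rw [inv_mul_el_same, tf_el s o N m hm.le l' hl']
      simp
    · rw [inv_mul_el, tf_el s o N (m + 1) hm]
      · simp [hj]; ring
      · rw [show 2 * (m + 1) + 1 = (2 * m + 2) + 1 by ring, mem_C_succ]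
        refine ⟨_, hl0, j, ?_, rfl⟩
        simpa using fun h => hj h.symm
  rw [Finset.sum_congr rfl (fun j _ => h1 j), Finset.sum_add_distrib]
  simp only [sum_const, card_univ, Fintype.card_fin, nsmul_eq_mul, sum_ite_eq', mem_univ, if_true]
  calc (k : ℝ) * s ^ (2 * m + 4) + (s ^ (2 * m + 2) - s ^ (2 * m + 4))
      = s ^ (2 * m + 2) * (s ^ 2 * ((k : ℝ) - 1)) + s ^ (2 * m + 2) := by ring
    _ = _ := by rw [hs]; ring

/-- The set on which the image of the test function is evaluated. -/
def G {k : ℕ} (o : Fin k) (N : ℕ) : Finset (FreeGroup (Fin k)) :=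
  ((range N).biUnion fun m => C o (2 * m + 2)).image (el true)

lemma tf_A_norm {k : ℕ} (hk : 2 ≤ k) (s : ℝ) (hs : s ^ 2 * ((k : ℝ) - 1) = 1)
    (o : Fin k) (N : ℕ) :
    ∑ x ∈ G o N, (∑ j, tf s o N ((FreeGroup.of j)⁻¹ * x)) ^ 2 = 4 * s ^ 2 * ((k : ℝ) - 1) * N := by
  rw [G, Finset.sum_image, Finset.sum_biUnion]
  · rw [Finset.sum_congr rfl (g := fun _ => 4)]
    · simp only [sum_const, card_range, nsmul_eq_mul]
      rw [mul_assoc 4, hs]; ring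
    · intro m hm
      rw [Finset.sum_congr rfl (g := fun _ => (2 * s ^ (2 * m + 2)) ^ 2)]
      · rw [Finset.sum_const, card_C, nsmul_eq_mul]
        push_cast [Nat.cast_sub (show 1 ≤ k by omega)]
        calc ((k : ℝ) - 1) ^ (2 * m + 2) * (2 * s ^ (2 * m + 2)) ^ 2
            = 4 * (s ^ 2 * ((k : ℝ) - 1)) ^ (2 * m + 2) := by rw [mul_pow (s ^ 2)]; ring
          _ = 4 := by rw [hs]; simp
      · intro l hl
        rw [tf_A s hs o N m (by simpa using hm) l hl]
  · intro m _ n _ h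
    exact C_disj o (by omega)
  · apply inj_el
    intro l hl
    simp only [coe_biUnion, Set.mem_iUnion] at hl
    obtain ⟨m, _, hl⟩ := hl
    exact (mem_C o _ l hl).2

end FGNorm


/-- The operator `A` of convolution by `T_k = u₁ + ⋯ + u_k` (the sum of the `k`
generators) on `ℓ²` of the free group `F_k`: `A` is bounded and its operator norm
is exactly `2√(k−1)`. -/
theorem freeGroup_generator_sum_norm (k : ℕ) (hk : 2 ≤ k)
    (A : (FreeGroup (Fin k) → ℂ) → (FreeGroup (Fin k) → ℂ))
    (hA : ∀ g x, A g x = ∑ i : Fin k, g ((FreeGroup.of i)⁻¹ * x)) :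
    (∀ g : FreeGroup (Fin k) → ℂ, Summable (fun x => ‖g x‖ ^ 2) →
      Summable (fun x => ‖A g x‖ ^ 2)) ∧
    IsLUB
      {c : ℝ | ∃ g : FreeGroup (Fin k) → ℂ,
        Summable (fun x => ‖g x‖ ^ 2) ∧ (∑' x, ‖g x‖ ^ 2) ≤ 1 ∧
        c = Real.sqrt (∑' x, ‖A g x‖ ^ 2)}
      (2 * Real.sqrt ((k : ℝ) - 1)) := by
  have hk' : (2 : ℝ) ≤ k := by exact_mod_cast hk
  set r := Real.sqrt ((k : ℝ) - 1) with hrdef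
  have hrk : r ^ 2 = (k : ℝ) - 1 := Real.sq_sqrt (by linarith)
  have hr : 1 ≤ r := by rw [hrdef, Real.one_le_sqrt]; linarith
  have hr0 : 0 < r := by linarith
  have hA' : ∀ g, A g = fun x => ∑ i : Fin k, g ((FreeGroup.of i)⁻¹ * x) := by
    intro g; funext x; exact hA g x
  refine ⟨fun g hg => ?_, ?_, ?_⟩
  · rw [hA' g]; exact (FGNorm.upper hk r hr hrk g hg).1
  · rintro c ⟨g, hg, hg1, rfl⟩
    rw [hA' g]
    apply Real.sqrt_le_iff.2
    refine ⟨by positivity, (FGNorm.upper hk r hr hrk g hg).2.trans ?_⟩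
    exact mul_le_of_le_one_right (by positivity) hg1
  · intro b hb
    have o : Fin k := ⟨0, by omega⟩
    set s := r⁻¹ with hsdef
    have hs0 : 0 < s := by positivity
    have hs : s ^ 2 * ((k : ℝ) - 1) = 1 := by
      rw [← hrk, hsdef]; field_simp
    have key : ∀ N : ℕ, 0 ≤ b ∧ (2 * r) ^ 2 * N ≤ b ^ 2 * (N + 1) := by
      intro N
      set M : ℝ := (N + 1) * s ^ 2 with hM
      have hM0 : 0 < M := by positivity
      set g : FreeGroup (Fin k) → ℂ :=
        fun y => (((Real.sqrt M)⁻¹ * FGNorm.tf s o N y : ℝ) : ℂ) with hgdef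
      have hg2 : ∀ y, ‖g y‖ ^ 2 = M⁻¹ * (FGNorm.tf s o N y) ^ 2 := by
        intro y
        rw [hgdef, Complex.norm_real, Real.norm_eq_abs, sq_abs, mul_pow, inv_pow,
          Real.sq_sqrt hM0.le]
      have hzero : ∀ y ∉ FGNorm.F o N, ‖g y‖ ^ 2 = 0 := by
        intro y hy
        rw [hg2, FGNorm.tf, if_neg hy]; simp
      have hgs : Summable (fun y => ‖g y‖ ^ 2) := summable_of_ne_finset_zero hzero
      have hgn : ∑' y, ‖g y‖ ^ 2 = 1 := by
        rw [tsum_eq_sum hzero]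
        simp only [hg2]
        rw [← Finset.mul_sum, FGNorm.tf_norm hk s hs o N, ← hM]
        exact inv_mul_cancel₀ hM0.ne'
      have hAs : Summable (fun x => ‖A g x‖ ^ 2) := by
        rw [hA' g]; exact (FGNorm.upper hk r hr hrk g hgs).1
      have hAn : M⁻¹ * (4 * s ^ 2 * ((k : ℝ) - 1) * N) ≤ ∑' x, ‖A g x‖ ^ 2 := by
        refine le_trans (le_of_eq ?_) (hAs.sum_le_tsum (FGNorm.G o N) (fun x _ => by positivity))
        rw [← FGNorm.tf_A_norm hk s hs o N, Finset.mul_sum]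
        apply Finset.sum_congr rfl
        intro x _
        rw [hA, hgdef]
        simp only
        rw [← Complex.ofReal_sum, Complex.norm_real, Real.norm_eq_abs, sq_abs, ← Finset.mul_sum,
          mul_pow, inv_pow, Real.sq_sqrt hM0.le]
      have hbb := hb ⟨g, hgs, hgn.le, rfl⟩
      obtain ⟨hb0, hb2⟩ := Real.sqrt_le_iff.1 hbb
      refine ⟨hb0, ?_⟩
      have h3 := hAn.trans hb2
      rw [inv_mul_le_iff₀ hM0, hM, ← hrk] at h3
      have hs2 : 0 < s ^ 2 := by positivity
      have h4 : s ^ 2 * ((2 * r) ^ 2 * N) ≤ s ^ 2 * (b ^ 2 * (N + 1)) := by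
        linarith
      exact le_of_mul_le_mul_left h4 hs2
    have hb0 := (key 0).1
    by_contra hlt
    push Not at hlt
    have hsq : b ^ 2 < (2 * r) ^ 2 := by gcongr
    obtain ⟨N, hN⟩ := exists_nat_gt (b ^ 2 / ((2 * r) ^ 2 - b ^ 2))
    rw [div_lt_iff₀ (by linarith)] at hN
    have := (key N).2
    linarith
end

section
/- For all n ≥ 1 and m ≥ 1, the number of multichains Φ₁ ≤ Φ₂ ≤ ⋯ ≤ Φₙ of length n in the poset NC(m) of noncrossing partitions of {1,…,m} (ordered by reverse refinement) equals the Fuss–Catalan number (1/m)·binom(m(n+1), m−1); equivalently, m times the number of such multichains equals binom(m(n+1), m−1). -/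
/-! ### The numbers `A n r m` -/

/-- Number of `r`-tuples of `(n+1)`-ary trees with `m` nodes in total. -/
def fcA (n : ℕ) : ℕ → ℕ → ℕ
  | 0 => fun r => (fun _ => 1) r
  | m + 1 => fun r => Nat.rec 0 (fun r' x => x + fcA n m (r' + 1 + n)) r

lemma fcA_zero (n r : ℕ) : fcA n 0 r = 1 := by simp [fcA]
lemma fcA_succ_zero (n m : ℕ) : fcA n (m+1) 0 = 0 := by simp [fcA]
lemma fcA_succ_succ (n m r : ℕ) :
    fcA n (m+1) (r+1) = fcA n (m+1) r + fcA n m (r + 1 + n) := by simp [fcA]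

lemma fcA_one (n m : ℕ) : fcA n (m+1) 1 = fcA n m (n+1) := by
  have := fcA_succ_succ n m 0
  rw [fcA_succ_zero] at this
  rw [show n + 1 = 0 + 1 + n by ring]
  simpa using this

lemma fcA_conv (n m : ℕ) : ∀ r s, fcA n m (r + s) =
    ∑ k ∈ Finset.range (m+1), fcA n k r * fcA n (m - k) s := by
  induction m with
  | zero => intro r s; simp [fcA_zero]
  | succ m ih =>
    intro r s
    induction r with
    | zero =>
      rw [Finset.sum_range_succ']
      simp [fcA_zero, fcA_succ_zero]
    | succ r ihr =>
      rw [show r + 1 + s = (r + s) + 1 by ring, fcA_succ_succ, ihr,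
        show r + s + 1 + n = (r + 1 + n) + s by ring, ih]
      rw [Finset.sum_range_succ' _ (m+1), Finset.sum_range_succ' _ (m+1)]
      simp only [fcA_succ_succ, fcA_zero, add_mul, Finset.sum_add_distrib]
      simp only [Nat.add_sub_add_right]
      ring

lemma fcA_closed (n m : ℕ) : ∀ r, (m+1) * fcA n (m+1) (r+1) =
    (r+1) * Nat.choose ((n+1)*(m+1) + r) m := by
  induction m with
  | zero =>
    intro r
    induction r with
    | zero => simp [fcA_succ_succ, fcA_zero, fcA_succ_zero]
    | succ r ih => 
      rw [fcA_succ_succ, mul_add, ih]; simp [fcA_zero]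
  | succ m ih =>
    have key : ∀ r, (m+1) * ((m+1+1) * fcA n (m+1+1) (r+1)) =
       (m+1) * ((r+1) * Nat.choose ((n+1)*(m+1+1) + r) (m+1)) := by
      intro r
      induction r using Nat.strong_induction_on with
      | _ r ihr =>
      have h0 : (m+1) * ((m+1+1) * fcA n (m+1+1) r) =
          (m+1) * (r * Nat.choose ((n+1)*(m+1+1) + r - 1) (m+1)) := by
        rcases r with _ | r
        · simp [fcA_succ_zero]
        · exact ihr r (by omega)
      have h1 := ih (r + n)
      rw [fcA_succ_succ]
      obtain ⟨N, hN⟩ : ∃ N, (n+1)*(m+1+1) + r = N + 1 := ⟨(n+1)*(m+1+1) + r - 1, by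
        have : 0 < (n+1)*(m+1+1) := by positivity
        omega⟩
      rw [hN] at h0 ⊢
      have h2 : (n+1)*(m+1) + (r+n) = N := by
        have : (n+1)*(m+1+1) = (n+1)*(m+1) + (n + 1) := by ring
        omega
      rw [h2] at h1
      rw [show r + n + 1 = r + 1 + n by ring] at h1
      have h3 := Nat.choose_succ_right_eq N m
      have h4 : N - m = n * m + 2 * n + 1 + r := by
        have : (n+1)*(m+1+1) = n * m + 2 * n + 2 + m := by ring
        omega
      rw [h4] at h3
      rw [Nat.choose_succ_succ]
      simp only [Nat.add_sub_cancel] at h0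
      zify at *
      linear_combination h0 + (m+2) * h1 + (-1) * h3
    intro r
    exact Nat.eq_of_mul_eq_mul_left (Nat.succ_pos m) (key r)

/-! ### Multichains as families of "block maximum" functions -/

structure IsMC {n : ℕ} (a b : ℕ) (f : Fin n → ℕ → ℕ) : Prop where
  le : ∀ j i, i ≤ f j i
  nc : ∀ j i i', i ≤ i' → i' ≤ f j i → f j i' ≤ f j i
  ch : ∀ j l, j ≤ l → ∀ i, f l (f j i) = f l i
  lo : ∀ j i, i < a → f j i = i
  hi : ∀ j i, b ≤ i → f j i = i
  bd : ∀ j i, i < b → f j i < b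

lemma IsMC.mono {n a b : ℕ} {f : Fin n → ℕ → ℕ} (h : IsMC a b f) {j l : Fin n} (hjl : j ≤ l)
    (i : ℕ) : f j i ≤ f l i := by
  rw [← h.ch j l hjl i]; exact h.le _ _

def TT (n t a b : ℕ) : Set (Fin n → ℕ → ℕ) :=
  {f | IsMC a b f ∧ ∀ l : Fin n, t ≤ l → f l a = b - 1}

def MC (n a b : ℕ) : Set (Fin n → ℕ → ℕ) := {f | IsMC a b f}

lemma MC_finite (n a b : ℕ) : (MC n a b).Finite := by
  have : Set.InjOn (fun (f : Fin n → ℕ → ℕ) (j : Fin n) (i : Fin b) => (Fin.ofNat (b+1) (f j i))) (MC n a b) := by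
    intro f hf g hg h
    funext j i
    by_cases hi : i < b
    · have := congrFun (congrFun h j) ⟨i, hi⟩
      simp only [Fin.ext_iff, Fin.ofNat] at this
      rwa [Nat.mod_eq_of_lt (by have := hf.bd j i hi; omega),
        Nat.mod_eq_of_lt (by have := hg.bd j i hi; omega)] at this
    · rw [hf.hi _ _ (not_lt.1 hi), hg.hi _ _ (not_lt.1 hi)]
  exact Set.Finite.of_finite_image (Set.toFinite _) this

lemma TT_sub (n t a b : ℕ) : TT n t a b ⊆ MC n a b := fun _ h => h.1

lemma TT_top (n a b : ℕ) : TT n n a b = MC n a b := by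
  ext f; simp [TT, MC]

lemma MC_empty (n a : ℕ) : (MC n a a).ncard = 1 := by
  rw [Set.ncard_eq_one]
  refine ⟨fun _ i => i, ?_⟩
  ext f
  constructor
  · intro h
    funext j i
    rcases lt_or_ge i a with hi | hi
    · exact h.lo j i hi
    · exact h.hi j i hi
  · rintro rfl
    constructor <;> intros <;> simp_all

lemma ncard_of_inv {α β : Type*} {s : Set α} {t : Set β} (f : α → β) (g : β → α)
    (hf : Set.MapsTo f s t) (hg : Set.MapsTo g t s) (h1 : Set.LeftInvOn g f s)
    (h2 : Set.RightInvOn g f t) : s.ncard = t.ncard := by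
  have hb : Set.BijOn f s t := Set.InvOn.bijOn ⟨h1, h2⟩ hf hg
  rw [← hb.image_eq, hb.injOn.ncard_image]

lemma TT_zero (n a b : ℕ) (hab : a < b) : (TT n 0 a b).ncard = (MC n (a+1) b).ncard := by
  refine ncard_of_inv (fun f l i => if i = a then a else f l i)
    (fun f l i => if i = a then b - 1 else f l i) ?_ ?_ ?_ ?_
  · rintro f ⟨⟨le, nc, ch, lo, hi, bd⟩, h⟩
    constructor <;> grind
  · rintro f ⟨le, nc, ch, lo, hi, bd⟩
    refine ⟨?_, ?_⟩
    · constructor <;> grind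
    · grind
  · rintro f ⟨⟨le, nc, ch, lo, hi, bd⟩, h⟩
    funext l i
    grind
  · rintro f ⟨le, nc, ch, lo, hi, bd⟩
    funext l i
    grind

lemma TT_fiber (n t a b k : ℕ) (ht : t < n) (hak : a ≤ k) (hkb : k < b) :
    {f ∈ TT n (t+1) a b | f ⟨t, ht⟩ a = k}.ncard =
      (TT n t a (k+1)).ncard * (MC n (k+1) b).ncard := by
  rw [← Set.ncard_prod]
  refine ncard_of_inv
    (fun f => (fun l i => if i ≤ k then min (f l i) k else i, fun l i => if k < i then f l i else i))
    (fun p l i => if k < i then p.2 l i else if t < l ∧ p.1 l i = k then b - 1 else p.1 l i)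
    ?_ ?_ ?_ ?_
  · rintro f ⟨⟨hf, h⟩, hk⟩
    have hm := fun j l hjl i => hf.mono (j := j) (l := l) hjl i
    have hm' : ∀ l : Fin n, t ≤ l → k ≤ f l a := by
      intro l hl
      rw [← hk]; exact hm _ _ hl a
    obtain ⟨le, nc, ch, lo, hi, bd⟩ := hf
    refine ⟨⟨?_, ?_⟩, ?_⟩
    · constructor
      · grind
      · grind
      · intro j l hjl i
        have e1 := ch j l hjl i
        have e2 := hm j l hjl i
        have e3 := le l k
        by_cases hik : i ≤ k
        · by_cases hjk : f j i ≤ k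
          · simp [hik, hjk, e1]
          · have h5 : min (f j i) k = k := by omega
            have h6 : min (f l i) k = k := by omega
            simp [hik, h5, h6, e3]
        · simp [hik]
      · grind
      · grind
      · grind
    · grind
    · constructor
      · grind
      · grind
      · intro j l hjl i
        have e1 := ch j l hjl i
        have e2 := le j i
        by_cases hik : k < i
        · have h5 : k < f j i := by omega
          simp [hik, h5, e1]
        · simp [hik]
      · grind
      · grind
      · grind
  · rintro ⟨g, h⟩ ⟨⟨hg, hgk⟩, hh⟩
    replace hg : IsMC a (k+1) g := hg
    replace hh : IsMC (k+1) b h := hh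
    replace hgk : ∀ l : Fin n, t ≤ l → g l a = k := hgk
    have hm := fun j l hjl i => hg.mono (j := j) (l := l) hjl i
    obtain ⟨le, nc, ch, lo, hi, bd⟩ := hg
    obtain ⟨le', nc', ch', lo', hi', bd'⟩ := hh
    refine ⟨⟨?_, ?_⟩, ?_⟩
    · constructor
      · grind
      · grind
      · intro j l hjl i
        have hjl' : (j : ℕ) ≤ l := hjl
        have e1 := ch j l hjl i
        have e1' := ch' j l hjl i
        have e2 := le' j i
        have e3 := hm j l hjl i
        by_cases hik : k < i
        · have h5 : k < h j i := by omega
          simp [hik, h5, e1']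
        · have e4 := bd j i (by omega)
          have e5 := bd l i (by omega)
          by_cases hjk : t < j ∧ g j i = k
          · have h6 : t < l ∧ g l i = k := by omega
            simp only [hik, hjk, h6, and_self, if_true, if_false]
            by_cases hb : k < b - 1
            · have e6 := bd' l (b-1) (by omega)
              have e7 := le' l (b-1)
              simp only [hb, if_true]; omega
            · have e6 : b - 1 = k := by omega
              have e7 := le l k
              have e8 := bd l k (by omega)
              have e9 : g l k = k := by omega
              simp [e6, e9]
          · have h7 : ¬ k < g j i := by omega
            simp only [hik, hjk, if_false, h7, e1]
      · grind
      · grind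
      · grind
    · grind
    · grind
  · rintro f ⟨⟨hf, h⟩, hk⟩
    have hm := fun j l hjl i => hf.mono (j := j) (l := l) hjl i
    have h1 : ∀ l : Fin n, t < l → f l k = b - 1 := by
      intro l hl
      rw [← h l hl, ← hk]; exact hf.ch _ _ (le_of_lt hl) a
    have h2 : ∀ l : Fin n, l ≤ t → ∀ i ≤ k, f l i ≤ k := by
      intro l hl i hi
      refine (hm l ⟨t, ht⟩ hl i).trans ?_
      rcases lt_or_ge i a with hia | hia
      · rw [hf.lo _ _ hia]; omega
      · rw [← hk]; exact hf.nc _ _ _ hia (by omega)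
    obtain ⟨le, nc, ch, lo, hi, bd⟩ := hf
    funext l i
    dsimp only
    by_cases hik : k < i
    · simp only [hik, if_true]
    · have hik' : i ≤ k := not_lt.1 hik
      simp only [hik, hik', if_true, if_false]
      by_cases htl : t < l
      · by_cases hfk : k ≤ f l i
        · have e1 := nc l i k hik' hfk
          have e2 := h1 l htl
          have e3 := bd l i (by omega)
          have e4 : t < l ∧ min (f l i) k = k := by omega
          rw [if_pos e4]; omega
        · rw [if_neg (by omega)]; omega
      · have e1 := h2 l (by omega) i hik'
        rw [if_neg (by omega)]; omega
  · rintro ⟨g, h⟩ ⟨⟨hg, hgk⟩, hh⟩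
    replace hg : IsMC a (k+1) g := hg
    replace hh : IsMC (k+1) b h := hh
    replace hgk : ∀ l : Fin n, t ≤ l → g l a = k := hgk
    obtain ⟨le, nc, ch, lo, hi, bd⟩ := hg
    obtain ⟨le', nc', ch', lo', hi', bd'⟩ := hh
    refine Prod.ext ?_ ?_
    · funext l i
      grind
    · funext l i
      grind

lemma TT_step (n t a m : ℕ) (ht : t < n) :
    (TT n (t+1) a (a+m+1)).ncard = ∑ k ∈ Finset.range (m+1),
      (TT n t a (a+k+1)).ncard * (MC n (a+k+1) (a+m+1)).ncard := by
  classical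
  have hfin : (TT n (t+1) a (a+m+1)).Finite := (MC_finite _ _ _).subset (TT_sub _ _ _ _)
  rw [Set.ncard_eq_toFinset_card _ hfin]
  rw [Finset.card_eq_sum_card_fiberwise (f := fun f => f ⟨t, ht⟩ a - a) (t := Finset.range (m+1))]
  · refine Finset.sum_congr rfl fun k hk => ?_
    rw [← TT_fiber n t a (a+m+1) (a+k) ht (by omega) (by simp at hk; omega),
      ← Set.ncard_coe_finset]
    congr 1
    ext f
    simp only [Finset.coe_filter, Set.Finite.mem_toFinset, Set.mem_ofPred_eq]
    refine and_congr_right fun hf => ?_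
    have := hf.1.le ⟨t, ht⟩ a
    omega
  · intro f hf
    simp only [Set.Finite.coe_toFinset] at hf
    have := hf.1.bd ⟨t, ht⟩ a (by omega)
    simp; omega

lemma MC_card (n m : ℕ) : ∀ a, (MC n a (a+m)).ncard = fcA n m 1 := by
  induction m using Nat.strong_induction_on with
  | _ m ih =>
    intro a
    rcases m with _ | m
    · simp [MC_empty, fcA_zero]
    · have key : ∀ t ≤ n, ∀ k ≤ m, (TT n t a (a+k+1)).ncard = fcA n k (t+1) := by
        intro t
        induction t with
        | zero =>
          intro _ k hk
          rw [TT_zero _ _ _ (by omega), show a + k + 1 = (a+1) + k by ring, ih k (by omega)]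
        | succ t iht =>
          intro ht k hk
          rw [TT_step _ _ _ _ ht, fcA_conv]
          refine Finset.sum_congr rfl fun l hl => ?_
          simp at hl
          rw [iht (by omega) l (by omega), show a + k + 1 = (a+l+1) + (k-l) by omega,
            ih _ (by omega)]
      rw [← TT_top, ← add_assoc, key n le_rfl m le_rfl, fcA_one]

/-! ### Passing to setoids -/

lemma setoid_card (n m : ℕ) : Set.ncard {Φ : Fin n → Setoid (Fin m) |
        (∀ j, IsNoncrossing (Φ j)) ∧ Monotone Φ} = (MC n 0 m).ncard := by
  classical
  symm
  refine Set.ncard_congr (fun f _ j => Setoid.ker (fun i : Fin m => f j i)) ?_ ?_ ?_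
  · intro f hf
    refine ⟨?_, ?_⟩
    · rintro j ⟨p, q, p', q', h1, h2, h3, h4, h5, h6⟩
      change f j p = f j p' at h4
      change f j q = f j q' at h5
      change ¬ f j p = f j q at h6
      have := hf.le j p'
      have := hf.le j q'
      have := hf.nc j p q (le_of_lt h1) (by have : (q:ℕ) < p' := h2; omega)
      have := hf.nc j q p' (le_of_lt h2) (by have : (p':ℕ) < q' := h3; omega)
      omega
    · intro j l hjl p q h
      change f j p = f j q at h
      change f l p = f l q
      rw [← hf.ch j l hjl p, h, hf.ch j l hjl]
  · have main : ∀ f g : Fin n → ℕ → ℕ, f ∈ MC n 0 m → g ∈ MC n 0 m →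
        (fun j => Setoid.ker (fun i : Fin m => f j i)) = (fun j => Setoid.ker (fun i : Fin m => g j i)) →
        ∀ j i, f j i ≤ g j i := by
      intro f g hf hg h j i
      rcases lt_or_ge i m with hi | hi
      · have h1 : (Setoid.ker (fun i : Fin m => f j i)).r ⟨f j i, hf.bd j i hi⟩ ⟨i, hi⟩ :=
          hf.ch j j le_rfl i
        have h' := congrFun h j
        rw [h'] at h1
        change g j (f j i) = g j i at h1
        rw [← h1]; exact hg.le _ _
      · rw [hf.hi _ _ hi, hg.hi _ _ hi]
    intro f g hf hg h
    funext j i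
    exact le_antisymm (main f g hf hg h j i) (main g f hg hf h.symm j i)
  · rintro Φ ⟨hnc, hmono⟩
    have hex : ∀ (j : Fin n) (i : Fin m), ∃ k : Fin m, (Φ j).r i k ∧ ∀ k', (Φ j).r i k' → k' ≤ k := by
      intro j i
      obtain ⟨k, hk, hk'⟩ := Finset.exists_max_image (Finset.univ.filter fun k => (Φ j).r i k) id
        ⟨i, by simpa using (Φ j).refl i⟩
      exact ⟨k, by simpa using hk, fun k' h => hk' k' (by simpa using h)⟩
    choose F hF hF' using hex
    have hFeq : ∀ j p q, (Φ j).r p q ↔ F j p = F j q := by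
      intro j p q
      constructor
      · intro h
        apply le_antisymm
        · exact hF' _ _ _ ((Φ j).trans ((Φ j).symm h) (hF j p))
        · exact hF' _ _ _ ((Φ j).trans h (hF j q))
      · intro h
        have := hF j p
        rw [h] at this
        exact (Φ j).trans this ((Φ j).symm (hF j q))
    have hle : ∀ j i, i ≤ F j i := fun j i => hF' _ _ _ ((Φ j).refl i)
    have hch : ∀ j l, j ≤ l → ∀ i, F l (F j i) = F l i := by
      intro j l hjl i
      exact ((hFeq l _ _).1 (hmono hjl (hF j i))).symm
    have hN : ∀ j i i', i ≤ i' → i' ≤ F j i → F j i' ≤ F j i := by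
      intro j i i' h1 h2
      by_contra hlt
      push Not at hlt
      rcases eq_or_lt_of_le h1 with rfl | h1
      · exact lt_irrefl _ hlt
      rcases eq_or_lt_of_le h2 with h2 | h2
      · rw [h2, hch j j le_rfl] at hlt; exact lt_irrefl _ hlt
      refine hnc j ⟨i, i', F j i, F j i', h1, h2, hlt, hF _ _, hF _ _, ?_⟩
      intro h
      rw [hFeq] at h
      rw [h] at hlt
      exact lt_irrefl _ hlt
    refine ⟨fun j i => if h : i < m then F j ⟨i, h⟩ else i, ?_, ?_⟩
    · constructor
      · intro j i
        split_ifs with h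
        · exact hle j ⟨i, h⟩
        · exact le_rfl
      · intro j i i' h1 h2
        by_cases h : i < m
        · simp only [h, dif_pos] at h2 ⊢
          have h' : i' < m := lt_of_le_of_lt h2 (F j ⟨i, h⟩).2
          simp only [h', dif_pos]
          exact hN j ⟨i, h⟩ ⟨i', h'⟩ h1 h2
        · simp only [h, dif_neg, not_false_eq_true] at h2 ⊢
          have : i' = i := le_antisymm h2 h1
          subst this
          simp [h]
      · intro j l hjl i
        by_cases h : i < m
        · simp [h, hch j l hjl]
        · simp [h]
      · intro j i h; omega
      · intro j i h
        simp [not_lt.2 h]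
      · intro j i h
        simp [h]
    · funext j
      ext p q
      change (_ = _) ↔ (Φ j).r p q
      rw [hFeq]
      simp [Fin.ext_iff]

/-- Edelman's enumeration: the number of multichains `Φ₁ ≤ ⋯ ≤ Φₙ` of length `n` in
the lattice `NC(m)` of noncrossing partitions of `{1,…,m}` (ordered by reverse
refinement) is the Fuss–Catalan number `(1/m)·binom(m(n+1), m−1)`; equivalently,
`m` times the number of multichains equals `binom(m(n+1), m−1)`. -/
theorem multichain_card_fussCatalan (n m : ℕ) (hn : 1 ≤ n) (hm : 1 ≤ m) :
    m * Set.ncard {Φ : Fin n → Setoid (Fin m) |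
        (∀ j, IsNoncrossing (Φ j)) ∧ Monotone Φ} =
      Nat.choose (m * (n + 1)) (m - 1) := by
  obtain ⟨m, rfl⟩ : ∃ k, m = k + 1 := ⟨m - 1, by omega⟩
  have h := MC_card n (m+1) 0
  rw [zero_add] at h
  rw [setoid_card, h]
  have := fcA_closed n m 0
  simp only [zero_add, one_mul, add_zero] at this
  rw [this, mul_comm (n+1)]
  simp
end

section
/- For n ≥ 1, let μ denote the Möbius function of the finite poset NC(n) of noncrossing partitions of {1,…,n} ordered by reverse refinement, let 0ₙ be its minimal element (the partition into singletons) and 1ₙ its maximal element (the partition with a single block). Then μ(0ₙ, 1ₙ) = (−1)^{n−1} · C_{n−1}, where C_{n−1} = (1/(n−1))·binom(2(n−1), n−2) is the (n−1)-st Catalan number (with C₀ = 1). -/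
namespace NCMoebius

open Finset IncidenceAlgebra

/-- Moebius functions agree along an order embedding onto an upper set. -/
lemma mu_transfer {A B : Type*} [PartialOrder A] [PartialOrder B] [Finite A]
    [LocallyFiniteOrder A] [LocallyFiniteOrder B] [DecidableEq A] [DecidableEq B]
    (e : A ↪o B) (hr : ∀ a y, e a ≤ y → ∃ c, e c = y) (a b : A) :
    mu ℤ (e a) (e b) = mu ℤ a b := by
  induction b using (wellFounded_lt (α := A)).induction with
  | _ b ih =>
    have hI : Ico (e a) (e b) = (Ico a b).map e.toEmbedding := by
      ext y
      simp only [mem_Ico, mem_map]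
      constructor
      · rintro ⟨h1, h2⟩
        obtain ⟨c, rfl⟩ := hr a y h1
        exact ⟨c, ⟨e.le_iff_le.1 h1, e.lt_iff_lt.1 h2⟩, rfl⟩
      · rintro ⟨c, ⟨h1, h2⟩, rfl⟩
        exact ⟨e.le_iff_le.2 h1, e.lt_iff_lt.2 h2⟩
    rw [mu_apply, mu_apply a b, hI, sum_map]
    simp only [EmbeddingLike.apply_eq_iff_eq]
    congr 2
    apply sum_congr rfl
    intro c hc
    exact ih c (mem_Ico.1 hc).2

/-- Weisner's theorem (dual form). -/
lemma weisner {A : Type*} [SemilatticeInf A] [BoundedOrder A] [Fintype A]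
    [LocallyFiniteOrder A] [DecidableEq A] (a : A) (ha : a ≠ ⊤) :
    ∑ x : A, (if x ⊓ a = ⊥ then mu ℤ x ⊤ else 0) = 0 := by
  classical
  have h1 : ∀ x : A, (if x ⊓ a = ⊥ then mu ℤ x ⊤ else 0)
      = ∑ y : A, if y ≤ x ∧ y ≤ a then mu ℤ ⊥ y * mu ℤ x ⊤ else 0 := by
    intro x
    have := sum_Icc_mu_right (𝕜 := ℤ) (⊥ : A) (x ⊓ a)
    have hf : Icc ⊥ (x ⊓ a) = univ.filter (fun y : A => y ≤ x ∧ y ≤ a) := by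
      ext y; simp
    rw [← sum_filter, ← sum_mul, ← hf, this]
    simp [eq_comm]
  simp_rw [h1]
  rw [sum_comm]
  apply sum_eq_zero
  intro y _
  by_cases hy : y ≤ a
  · have := sum_Icc_mu_left (𝕜 := ℤ) y (⊤ : A)
    have hf : Icc y ⊤ = univ.filter (fun x : A => y ≤ x ∧ y ≤ a) := by
      ext x; simp [hy]
    rw [← sum_filter, ← mul_sum, ← hf, this, if_neg, mul_zero]
    rintro rfl
    exact ha (top_le_iff.1 hy)
  · simp [hy]

lemma nc_inf {N : ℕ} {x y : Setoid (Fin N)} (hx : IsNoncrossing x) (hy : IsNoncrossing y) :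
    IsNoncrossing (x ⊓ y) := by
  rintro ⟨p, q, p', q', h1, h2, h3, h4, h5, h6⟩
  apply h6
  refine ⟨?_, ?_⟩
  · by_contra h
    exact hx ⟨p, q, p', q', h1, h2, h3, h4.1, h5.1, h⟩
  · by_contra h
    exact hy ⟨p, q, p', q', h1, h2, h3, h4.2, h5.2, h⟩

lemma nc_bot {N : ℕ} : IsNoncrossing (⊥ : Setoid (Fin N)) := by
  rintro ⟨p, q, p', q', h1, h2, h3, h4, h5, h6⟩
  have : p = p' := h4
  subst this
  exact absurd (h1.trans h2) (lt_irrefl _)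

lemma nc_top {N : ℕ} : IsNoncrossing (⊤ : Setoid (Fin N)) := by
  rintro ⟨p, q, p', q', h1, h2, h3, h4, h5, h6⟩
  exact h6 trivial

/-- The lattice of noncrossing partitions. -/
abbrev NC (N : ℕ) := {π : Setoid (Fin N) // IsNoncrossing π}

noncomputable instance (N : ℕ) : SemilatticeInf (NC N) := Subtype.semilatticeInf fun _ _ => nc_inf
noncomputable instance (N : ℕ) : BoundedOrder (NC N) where
  bot := ⟨⊥, nc_bot⟩
  bot_le x := (bot_le : ⊥ ≤ x.1)
  top := ⟨⊤, nc_top⟩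
  le_top x := (le_top : x.1 ≤ ⊤)

instance (N : ℕ) : Finite (Setoid (Fin N)) :=
  Finite.of_injective (fun s : Setoid (Fin N) => fun x y => s.r x y) (by
    intro s t h
    ext x y
    have := congrFun (congrFun h x) y
    exact iff_of_eq this)

noncomputable instance (N : ℕ) : Fintype (NC N) := Fintype.ofFinite _
noncomputable instance (N : ℕ) : DecidableEq (NC N) := Classical.decEq _
noncomputable instance (N : ℕ) : DecidableLE (NC N) := fun _ _ => Classical.dec _
noncomputable instance (N : ℕ) : DecidableLT (NC N) := fun _ _ => Classical.dec _
noncomputable instance (N : ℕ) : LocallyFiniteOrder (NC N) :=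
  Fintype.toLocallyFiniteOrder

/-- The quantity to be computed. -/
noncomputable def f (N : ℕ) : ℤ := mu ℤ (⊥ : NC N) ⊤

open Classical in
/-- The gluing label function. -/
noncomputable def lab {a b : ℕ} (σ : Setoid (Fin (a + 1))) (τ : Setoid (Fin (b + 1))) :
    Fin ((a + 1) + (b + 1)) → Quotient σ ⊕ Quotient τ :=
  Fin.addCases (fun i => Sum.inl (Quotient.mk σ i))
    (fun j => if τ.r j (Fin.last b) then Sum.inl (Quotient.mk σ (Fin.last a))
      else Sum.inr (Quotient.mk τ j))

/-- Gluing two partitions along their last elements. -/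
noncomputable def glue {a b : ℕ} (σ : Setoid (Fin (a + 1))) (τ : Setoid (Fin (b + 1))) :
    Setoid (Fin ((a + 1) + (b + 1))) := Setoid.ker (lab σ τ)

section
variable {a b : ℕ} (σ : Setoid (Fin (a + 1))) (τ : Setoid (Fin (b + 1)))

lemma glue_ll (i i' : Fin (a + 1)) :
    (glue σ τ).r (Fin.castAdd _ i) (Fin.castAdd _ i') ↔ σ.r i i' := by
  change lab σ τ _ = lab σ τ _ ↔ _
  simp only [lab, Fin.addCases_left, Sum.inl.injEq]
  exact Quotient.eq

lemma glue_rr (j j' : Fin (b + 1)) :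
    (glue σ τ).r (Fin.natAdd _ j) (Fin.natAdd _ j') ↔ τ.r j j' := by
  change lab σ τ _ = lab σ τ _ ↔ _
  simp only [lab, Fin.addCases_right]
  split_ifs with h h' h'
  · exact iff_of_true rfl (τ.trans' h (τ.symm' h'))
  · simp only [reduceCtorEq, false_iff]
    exact fun hh => h' (τ.trans' (τ.symm' hh) h)
  · simp only [reduceCtorEq, false_iff]
    exact fun hh => h (τ.trans' hh h')
  · simp only [Sum.inr.injEq]
    exact Quotient.eq

lemma glue_lr (i : Fin (a + 1)) (j : Fin (b + 1)) :
    (glue σ τ).r (Fin.castAdd _ i) (Fin.natAdd _ j) ↔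
      σ.r i (Fin.last a) ∧ τ.r j (Fin.last b) := by
  change lab σ τ _ = lab σ τ _ ↔ _
  simp only [lab, Fin.addCases_left, Fin.addCases_right]
  split_ifs with h
  · simp only [Sum.inl.injEq, h, and_true]
    exact Quotient.eq
  · simp [h]

lemma glue_rl (i : Fin (a + 1)) (j : Fin (b + 1)) :
    (glue σ τ).r (Fin.natAdd _ j) (Fin.castAdd _ i) ↔
      σ.r i (Fin.last a) ∧ τ.r j (Fin.last b) := by
  rw [← glue_lr]
  exact ⟨fun h => (glue σ τ).symm' h, fun h => (glue σ τ).symm' h⟩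

lemma nc_out {N : ℕ} {π : Setoid (Fin N)} (h : IsNoncrossing π) {p q p' q' : Fin N}
    (h1 : p < q) (h2 : q < p') (h3 : p' < q') (h4 : π.r p p') (h5 : π.r q q') : π.r p q := by
  by_contra h6
  exact h ⟨p, q, p', q', h1, h2, h3, h4, h5, h6⟩

lemma nc_glue (hσ : IsNoncrossing σ) (hτ : IsNoncrossing τ) : IsNoncrossing (glue σ τ) := by
  rintro ⟨p, q, p', q', h1, h2, h3, h4, h5, h6⟩
  apply h6
  clear h6
  have lr : ∀ (i : Fin (a+1)) (j : Fin (b+1)),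
      ¬ (Fin.natAdd (a+1) j < Fin.castAdd (b+1) i) := by
    intro i j h
    have := i.2
    simp only [Fin.lt_def, Fin.val_natAdd, Fin.val_castAdd] at h
    omega
  have ll : ∀ (i j : Fin (a+1)), Fin.castAdd (b+1) i < Fin.castAdd (b+1) j ↔ i < j := by
    intro i j; simp only [Fin.lt_def, Fin.val_natAdd, Fin.val_castAdd]
  have rr : ∀ (i j : Fin (b+1)), Fin.natAdd (a+1) i < Fin.natAdd (a+1) j ↔ i < j := by
    intro i j; simp only [Fin.lt_def, Fin.val_natAdd, Fin.val_castAdd]; omega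
  induction p using Fin.addCases <;> induction q using Fin.addCases <;>
    induction p' using Fin.addCases <;> induction q' using Fin.addCases <;>
    first
    | exact absurd h1 (lr _ _)
    | exact absurd h2 (lr _ _)
    | exact absurd h3 (lr _ _)
    | skip
  all_goals simp only [glue_ll, glue_lr, glue_rr, ll, rr] at *
  · exact nc_out hσ h1 h2 h3 h4 h5
  · rcases (Fin.le_last _).lt_or_eq with h | h
    · exact nc_out hσ h1 h2 h h4 h5.1
    · exact σ.trans' (h ▸ h4) (σ.symm' h5.1)
  · exact σ.trans' h4.1 (σ.symm' h5.1)
  · refine ⟨h4.1, ?_⟩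
    rcases (Fin.le_last _).lt_or_eq with h | h
    · exact τ.trans' (nc_out hτ h2 h3 h h5 h4.2) h4.2
    · exact h ▸ h5
  · exact nc_out hτ h1 h2 h3 h4 h5

lemma nc_comap {M N : ℕ} (g : Fin M → Fin N) (hg : StrictMono g) {π : Setoid (Fin N)}
    (h : IsNoncrossing π) : IsNoncrossing (Setoid.comap g π) := by
  rintro ⟨p, q, p', q', h1, h2, h3, h4, h5, h6⟩
  exact h ⟨g p, g q, g p', g q', hg h1, hg h2, hg h3, h4, h5, h6⟩

end

/-- Gluing as an order embedding. -/
noncomputable def glueEmb (a b : ℕ) : NC (a + 1) × NC (b + 1) ↪o NC ((a + 1) + (b + 1)) :=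
  OrderEmbedding.ofMapLEIff (fun p => ⟨glue p.1.1 p.2.1, nc_glue _ _ p.1.2 p.2.2⟩) (by
    rintro ⟨⟨σ, hσ⟩, ⟨τ, hτ⟩⟩ ⟨⟨σ', hσ'⟩, ⟨τ', hτ'⟩⟩
    change (∀ {x y}, (glue σ τ).r x y → (glue σ' τ').r x y) ↔
      (∀ {x y}, σ.r x y → σ'.r x y) ∧ (∀ {x y}, τ.r x y → τ'.r x y)
    constructor
    · intro h
      refine ⟨fun {x y} hxy => ?_, fun {x y} hxy => ?_⟩
      · exact (glue_ll σ' τ' x y).1 (h ((glue_ll σ τ x y).2 hxy))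
      · exact (glue_rr σ' τ' x y).1 (h ((glue_rr σ τ x y).2 hxy))
    · rintro ⟨h1, h2⟩ x y hxy
      induction x using Fin.addCases <;> induction y using Fin.addCases <;>
        simp only [glue_ll, glue_lr, glue_rl, glue_rr] at hxy ⊢
      · exact h1 hxy
      · exact ⟨h1 hxy.1, h2 hxy.2⟩
      · exact ⟨h1 hxy.1, h2 hxy.2⟩
      · exact h2 hxy)

lemma glueEmb_val {a b : ℕ} (p : NC (a + 1) × NC (b + 1)) :
    (glueEmb a b p).1 = glue p.1.1 p.2.1 := rfl

lemma glue_surj {a b : ℕ} (π : NC ((a + 1) + (b + 1)))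
    (h : π.1.r (Fin.castAdd _ (Fin.last a)) (Fin.natAdd _ (Fin.last b))) :
    ∃ c, glueEmb a b c = π := by
  obtain ⟨π, hπ⟩ := π
  refine ⟨(⟨Setoid.comap (Fin.castAdd (b+1)) π, nc_comap _ (Fin.strictMono_castAdd _) hπ⟩,
    ⟨Setoid.comap (Fin.natAdd (a+1)) π, nc_comap _ (Fin.strictMono_natAdd _) hπ⟩), ?_⟩
  apply Subtype.ext
  rw [glueEmb_val]
  change π.r _ _ at h
  have key : ∀ (i : Fin (a+1)) (j : Fin (b+1)), π.r (Fin.castAdd _ i) (Fin.natAdd _ j) ↔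
      π.r (Fin.castAdd _ i) (Fin.castAdd _ (Fin.last a)) ∧
      π.r (Fin.natAdd _ j) (Fin.natAdd _ (Fin.last b)) := by
    intro i j
    constructor
    · intro hij
      have h1 : π.r (Fin.castAdd _ i) (Fin.castAdd _ (Fin.last a)) := by
        rcases (Fin.le_last i).lt_or_eq with hi | hi
        · rcases (Fin.le_last j).lt_or_eq with hj | hj
          · refine nc_out hπ ?_ ?_ ?_ hij h
            · simpa [Fin.lt_def] using hi
            · simp only [Fin.lt_def, Fin.val_natAdd, Fin.val_castAdd, Fin.val_last]; omega
            · simpa [Fin.lt_def] using hj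
          · subst hj
            exact π.trans' hij (π.symm' h)
        · subst hi
          exact π.refl' _
      exact ⟨h1, π.trans' (π.symm' hij) (π.trans' h1 h)⟩
    · rintro ⟨h1, h2⟩
      exact π.trans' h1 (π.trans' h (π.symm' h2))
  apply Setoid.ext
  intro x y
  change (glue _ _).r x y ↔ π.r x y
  induction x using Fin.addCases <;> induction y using Fin.addCases <;>
    simp only [glue_ll, glue_lr, glue_rl, glue_rr]
  · rfl
  · exact (key _ _).symm
  · exact (key _ _).symm.trans ⟨fun h => π.symm' h, fun h => π.symm' h⟩
  · rfl

/-- The atom joining `k` to the last point. -/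
def pairS {m : ℕ} (k : Fin m) : Setoid (Fin (m + 1)) where
  r x y := x = y ∨ ((x = k.castSucc ∨ x = Fin.last m) ∧ (y = k.castSucc ∨ y = Fin.last m))
  iseqv := ⟨fun _ => Or.inl rfl, by grind, by grind⟩

lemma pairS_r {m : ℕ} (k : Fin m) (x y : Fin (m+1)) : (pairS k).r x y ↔
  (x = y ∨ ((x = k.castSucc ∨ x = Fin.last m) ∧ (y = k.castSucc ∨ y = Fin.last m))) := Iff.rfl

lemma nc_pair {m : ℕ} (k : Fin m) : IsNoncrossing (pairS k) := by
  rintro ⟨p, q, p', q', h1, h2, h3, h4, h5, h6⟩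
  rw [pairS_r] at h4 h5 h6
  grind

/-- The atom as an element of NC. -/
def pair {m : ℕ} (k : Fin m) : NC (m + 1) := ⟨pairS k, nc_pair k⟩

lemma pair_le {m : ℕ} (k : Fin m) (π : NC (m + 1)) :
    pair k ≤ π ↔ π.1.r k.castSucc (Fin.last m) := by
  constructor
  · intro h
    exact h (Or.inr ⟨Or.inl rfl, Or.inr rfl⟩)
  · intro h x y hxy
    rcases hxy with rfl | ⟨rfl | rfl, rfl | rfl⟩
    · exact π.1.refl' _
    · exact π.1.refl' _
    · exact h
    · exact π.1.symm' h
    · exact π.1.refl' _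

lemma mu_pair_aux (a b : ℕ) (k : Fin (a + 1 + b)) (hk : k.val = a) :
    mu ℤ (pair k : NC ((a + 1 + b) + 1)) ⊤ = f (a + 1) * f (b + 1) := by
  have e1 : k.castSucc = Fin.castAdd (b + 1) (Fin.last a) := by
    ext; simp [hk]
  have e2 : Fin.last (a + 1 + b) = Fin.natAdd (a + 1) (Fin.last b) := by
    ext; simp
  have hle : ∀ π : NC ((a + 1) + (b + 1)), pair k ≤ π ↔ ∃ c, glueEmb a b c = π := by
    intro π
    have := pair_le k π
    rw [e1, e2] at this
    refine this.trans ⟨glue_surj π, ?_⟩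
    rintro ⟨c, rfl⟩
    rw [glueEmb_val, glue_lr]
    exact ⟨Setoid.refl' _ _, Setoid.refl' _ _⟩
  have hbot : glueEmb a b ⊥ = pair k := by
    apply le_antisymm
    · obtain ⟨c, hc⟩ := (hle (pair k)).1 le_rfl
      rw [← hc]
      exact (glueEmb a b).monotone bot_le
    · exact (hle _).2 ⟨_, rfl⟩
  have htop : glueEmb a b ⊤ = ⊤ := by
    obtain ⟨c, hc⟩ := (hle ⊤).1 le_top
    apply top_le_iff.1
    rw [← hc]
    exact (glueEmb a b).monotone le_top
  have := mu_transfer (glueEmb a b) (by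
    intro c y hy
    exact (hle y).1 (((hle _).2 ⟨c, rfl⟩).trans hy)) ⊥ ⊤
  rw [hbot, htop] at this
  refine this.trans ?_
  rw [← mu_prod_mu]
  rfl

lemma mu_pair {m : ℕ} (k : Fin (m + 1)) :
    mu ℤ (pair k) ⊤ = f (k.val + 1) * f (m - k.val + 1) := by
  obtain ⟨a, ha⟩ : ∃ a, k.val = a := ⟨_, rfl⟩
  obtain ⟨b, hb⟩ : ∃ b, m - k.val = b := ⟨_, rfl⟩
  have hm : m + 1 = a + 1 + b := by omega
  rw [hb, ha]
  clear hb
  generalize m + 1 = M at k hm ha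
  subst hm
  exact mu_pair_aux a b k ha

/-- The coatom isolating the last point. -/
def coS (m : ℕ) : Setoid (Fin (m + 1)) where
  r x y := x = y ∨ (x ≠ Fin.last m ∧ y ≠ Fin.last m)
  iseqv := ⟨fun _ => Or.inl rfl, by grind, by grind⟩

lemma coS_r {m : ℕ} (x y : Fin (m+1)) : (coS m).r x y ↔
  (x = y ∨ (x ≠ Fin.last m ∧ y ≠ Fin.last m)) := Iff.rfl

lemma nc_co (m : ℕ) : IsNoncrossing (coS m) := by
  rintro ⟨p, q, p', q', h1, h2, h3, h4, h5, h6⟩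
  rw [coS_r] at h4 h5 h6
  have := Fin.le_last q'
  grind

/-- The coatom as an element of NC. -/
def co (m : ℕ) : NC (m + 1) := ⟨coS m, nc_co m⟩

lemma co_ne_top (m : ℕ) : co (m + 1) ≠ ⊤ := by
  intro h
  have : (co (m+1)).1.r 0 (Fin.last _) := by rw [h]; trivial
  rcases this with h | h
  · simp [Fin.ext_iff] at h
  · exact h.2 rfl

lemma inf_co {m : ℕ} (x : NC (m + 1)) : x ⊓ co m = ⊥ ↔ x = ⊥ ∨ ∃ k, x = pair k := by
  have hx : x ⊓ co m = ⊥ ↔ ∀ p q, x.1.r p q → (coS m).r p q → p = q := by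
    rw [← le_bot_iff]
    constructor
    · intro h p q h1 h2
      exact h ⟨h1, h2⟩
    · intro h p q hpq
      exact h p q hpq.1 hpq.2
  rw [hx]
  constructor
  · intro h
    by_cases hk : ∃ k : Fin m, x.1.r k.castSucc (Fin.last m)
    · right
      obtain ⟨k, hk⟩ := hk
      refine ⟨k, le_antisymm ?_ ((pair_le k x).2 hk)⟩
      intro p q hpq
      change (pairS k).r p q
      rw [pairS_r]
      have hpq : x.1.r p q := hpq
      have hl : ∀ p, x.1.r p (Fin.last m) → p = k.castSucc ∨ p = Fin.last m := by
        intro p hp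
        by_cases hpl : p = Fin.last m
        · exact Or.inr hpl
        · exact Or.inl (h _ _ (x.1.trans' hp (x.1.symm' hk))
            (Or.inr ⟨hpl, (Fin.castSucc_lt_last k).ne⟩))
      by_cases h1 : p = q
      · exact Or.inl h1
      right
      by_cases hp : p = Fin.last m
      · exact ⟨Or.inr hp, hl q (x.1.symm' (hp ▸ hpq))⟩
      by_cases hq : q = Fin.last m
      · exact ⟨hl p (hq ▸ hpq), Or.inr hq⟩
      exact absurd (h p q hpq (Or.inr ⟨hp, hq⟩)) h1
    · left
      rw [← le_bot_iff]
      intro p q hpq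
      have hpq : x.1.r p q := hpq
      change p = q
      push Not at hk
      have hl : ∀ p, x.1.r p (Fin.last m) → p = Fin.last m := by
        intro p hp
        by_contra hpl
        obtain ⟨k, rfl⟩ := Fin.exists_castSucc_eq.2 hpl
        exact hk k hp
      by_cases hp : p = Fin.last m
      · subst hp
        exact (hl q (x.1.symm' hpq)).symm
      by_cases hq : q = Fin.last m
      · subst hq
        exact hl p hpq
      exact h p q hpq (Or.inr ⟨hp, hq⟩)
  · rintro (rfl | ⟨k, rfl⟩) p q h1 h2
    · exact h1
    · change (pairS k).r p q at h1
      rw [pairS_r] at h1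
      rw [coS_r] at h2
      grind

lemma pair_inj {m : ℕ} : Function.Injective (pair : Fin m → NC (m + 1)) := by
  intro k l h
  have : (pair l).1.r k.castSucc (Fin.last m) := (pair_le k _).1 h.le
  change (pairS l).r _ _ at this
  rw [pairS_r] at this
  have h1 := (Fin.castSucc_lt_last k).ne
  rcases this with h | ⟨h | h, -⟩
  · exact absurd h h1
  · exact Fin.castSucc_injective _ h
  · exact absurd h h1

lemma pair_ne_bot {m : ℕ} (k : Fin m) : pair k ≠ ⊥ := by
  intro h
  have : (⊥ : NC (m+1)).1.r k.castSucc (Fin.last m) := (pair_le k _).1 h.le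
  exact (Fin.castSucc_lt_last k).ne this

lemma f_rec (m : ℕ) : f (m + 2) = -∑ k : Fin (m + 1), f (k.val + 1) * f (m - k.val + 1) := by
  have hw := weisner (co (m + 1)) (co_ne_top m)
  rw [← sum_filter] at hw
  have hf : univ.filter (fun x : NC (m + 1 + 1) => x ⊓ co (m + 1) = ⊥) =
      insert ⊥ (univ.image (pair : Fin (m + 1) → NC (m + 1 + 1))) := by
    ext x
    simp only [mem_filter, mem_univ, true_and, mem_insert, mem_image, inf_co]
    simp only [eq_comm]
  rw [hf, sum_insert, sum_image (fun _ _ _ _ h => pair_inj h)] at hw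
  · simp_rw [mu_pair] at hw
    exact eq_neg_of_add_eq_zero_left hw
  · simp only [mem_image, mem_univ, true_and, not_exists]
    exact fun k => pair_ne_bot k

lemma f_one : f 1 = 1 := by
  have : (⊥ : NC 1) = ⊤ := by
    apply Subtype.ext
    apply Setoid.ext
    intro x y
    exact iff_of_true (Subsingleton.elim x y) trivial
  rw [f, this, mu_self]

lemma f_eq (m : ℕ) : f (m + 1) = (-1) ^ m * (catalan m : ℤ) := by
  induction m using Nat.strong_induction_on with
  | _ m ih =>
    rcases m with _ | m
    · simp [f_one]
    · rw [f_rec, catalan_succ]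
      push_cast
      rw [mul_sum, ← sum_neg_distrib]
      apply sum_congr rfl
      intro k _
      have hk := k.2
      rw [ih k.val hk, ih (m - k.val) (by omega)]
      have : (-1 : ℤ) ^ (m + 1) = -((-1) ^ k.val * (-1) ^ (m - k.val)) := by
        rw [← pow_add, show k.val + (m - k.val) = m by omega, pow_succ]
        ring
      rw [this]
      ring

end NCMoebius

/-- The Möbius function of the lattice `NC(n)` of noncrossing partitions (ordered by
reverse refinement, which is the order induced from the lattice of equivalence
relations, with `0ₙ = ⊥` the partition into singletons and `1ₙ = ⊤` the one-block
partition) satisfies `μ(0ₙ, 1ₙ) = (−1)^{n−1} C_{n−1}`.  Here `μ` is any function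
satisfying the defining recursion of the Möbius function of the poset `NC(n)`. -/
theorem nc_moebius_bot_top (n : ℕ) (hn : 1 ≤ n)
    (μ : Setoid (Fin n) → Setoid (Fin n) → ℤ)
    (hdiag : ∀ x : Setoid (Fin n), IsNoncrossing x → μ x x = 1)
    (hsum : ∀ x y : Setoid (Fin n), IsNoncrossing x → IsNoncrossing y → x < y →
      (∑ᶠ z ∈ {z : Setoid (Fin n) | IsNoncrossing z ∧ x ≤ z ∧ z ≤ y}, μ x z) = 0) :
    μ ⊥ ⊤ = (-1) ^ (n - 1) * (catalan (n - 1) : ℤ) := by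
  have hmain : ∀ z : NCMoebius.NC n, μ ⊥ z.1 = IncidenceAlgebra.mu ℤ ⊥ z := by
    intro z
    induction z using (wellFounded_lt (α := NCMoebius.NC n)).induction with
    | _ z ih =>
      by_cases hz : ⊥ = z
      · subst hz
        rw [IncidenceAlgebra.mu_self]
        exact hdiag _ NCMoebius.nc_bot
      · have hlt : (⊥ : Setoid (Fin n)) < z.1 :=
          bot_lt_iff_ne_bot.2 fun h => hz (Subtype.ext h.symm)
        have hs := hsum ⊥ z.1 NCMoebius.nc_bot z.2 hlt
        have hset : {w : Setoid (Fin n) | IsNoncrossing w ∧ ⊥ ≤ w ∧ w ≤ z.1} =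
            ((Finset.Icc ⊥ z).map (Function.Embedding.subtype _) : Finset (Setoid (Fin n))) := by
          ext w
          simp only [Set.mem_ofPred_eq, Finset.coe_map, Set.mem_image, Finset.mem_coe,
            Finset.mem_Icc, Function.Embedding.subtype_apply]
          constructor
          · rintro ⟨h1, -, h2⟩
            exact ⟨⟨w, h1⟩, ⟨bot_le, h2⟩, rfl⟩
          · rintro ⟨v, ⟨-, h2⟩, rfl⟩
            exact ⟨v.2, bot_le, h2⟩
        rw [hset, finsum_mem_coe_finset, Finset.sum_map, Finset.Icc_eq_cons_Ico bot_le,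
          Finset.sum_cons] at hs
        rw [IncidenceAlgebra.mu_eq_neg_sum_Ico_of_ne hz]
        have hc : ∑ x ∈ Finset.Ico ⊥ z, μ ⊥ (Function.Embedding.subtype _ x) =
            ∑ x ∈ Finset.Ico ⊥ z, IncidenceAlgebra.mu ℤ ⊥ x :=
          Finset.sum_congr rfl fun x hx => ih x (Finset.mem_Ico.1 hx).2
        rw [hc] at hs
        exact eq_neg_of_add_eq_zero_left hs
  obtain ⟨m, rfl⟩ : ∃ m, n = m + 1 := ⟨n - 1, by omega⟩
  exact (hmain ⊤).trans (NCMoebius.f_eq m)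
end
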